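/- arXiv:1803.02968 — 5 statements merged into one kernel-verified Lean document; each statement's English description precedes it below -/
import Mathlib

section
/- Let M(W1, W2) = W1·W2 be the matrix multiplication mapping with W1 ∈ ℝ^{m×k}, W2 ∈ ℝ^{k×n}, and assume k < min(m, n). If rank(W̄1) ≠ rank(W̄2), then M is not locally open at (W̄1, W̄2) relative to its range R_M. If rank(W̄1) = rank(W̄2), then the following are equivalent: (i) there exists W̃1 ∈ ℝ^{m×k} with W̃1·W̄2 = 0 such that W̄1 + W̃1 has full column rank; (ii) there exists W̃2 ∈ ℝ^{k×n} with W̄1·W̃2 = 0 such that W̄2 + W̃2 has full row rank; (iii) the intersection of the null space of W̄1 with the column space of W̄2 is {0}; (iv) the intersection of the null space of W̄2ᵀ with the column space of W̄1ᵀ is {0}; (v) M is locally open at (W̄1, W̄2) relative to its range R_M. -/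
open Matrix

/-- Frobenius norm of a real matrix. -/
noncomputable def frob {m n : ℕ} (A : Matrix (Fin m) (Fin n) ℝ) : ℝ :=
  Real.sqrt (∑ i, ∑ j, (A i j) ^ 2)

/-- Local openness of the matrix multiplication mapping `M(W1, W2) = W1 * W2` at `(W1, W2)`
relative to its range `R_M = {Z : rank Z ≤ min (m, n, k)}`, with respect to the Frobenius
norm (and the corresponding product metric on pairs). -/
def MulLocOpenAt {m k n : ℕ} (W1 : Matrix (Fin m) (Fin k) ℝ)
    (W2 : Matrix (Fin k) (Fin n) ℝ) : Prop :=
  ∀ ε > 0, ∃ δ > 0, ∀ Z : Matrix (Fin m) (Fin n) ℝ,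
    Z.rank ≤ min m (min n k) → frob (Z - W1 * W2) < δ →
      ∃ (V1 : Matrix (Fin m) (Fin k) ℝ) (V2 : Matrix (Fin k) (Fin n) ℝ),
        frob (V1 - W1) < ε ∧ frob (V2 - W2) < ε ∧ V1 * V2 = Z

theorem exists_left_inverse_of_rank_eq {m k : ℕ} (A : Matrix (Fin m) (Fin k) ℝ)
    (h : A.rank = k) : ∃ L : Matrix (Fin k) (Fin m) ℝ, L * A = 1 := by
  have hker : LinearMap.ker A.mulVecLin = ⊥ := by
    have := A.mulVecLin.finrank_range_add_finrank_ker
    rw [← Matrix.rank, h, Module.finrank_fin_fun] at this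
    exact Submodule.finrank_eq_zero.mp (by omega)
  obtain ⟨g, hg⟩ := LinearMap.exists_leftInverse_of_injective _ hker
  refine ⟨LinearMap.toMatrix' g, ?_⟩
  have := congrArg LinearMap.toMatrix' hg
  rwa [LinearMap.toMatrix'_comp, ← Matrix.toLin'_apply', LinearMap.toMatrix'_toLin',
    LinearMap.toMatrix'_id] at this

theorem exists_right_inverse_of_rank_eq {k n : ℕ} (A : Matrix (Fin k) (Fin n) ℝ)
    (h : A.rank = k) : ∃ X : Matrix (Fin n) (Fin k) ℝ, A * X = 1 := by
  obtain ⟨L, hL⟩ := exists_left_inverse_of_rank_eq Aᵀ (by rw [rank_transpose, h])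
  exact ⟨Lᵀ, by rw [← transpose_transpose A, ← transpose_mul, hL, transpose_one]⟩

theorem rank_eq_of_mul_eq_one {m k : ℕ} {L : Matrix (Fin k) (Fin m) ℝ}
    {A : Matrix (Fin m) (Fin k) ℝ} (h : L * A = 1) : A.rank = k := by
  have h1 := rank_mul_le_right L A
  rw [h, rank_one, Fintype.card_fin] at h1
  exact le_antisymm (rank_le_width A) h1

/-- A `q`-dimensional coordinate frame inside the kernel of `Y`, with a left inverse. -/
theorem exists_frame_in_ker {m r q : ℕ} (Y : Matrix (Fin r) (Fin m) ℝ) (h : q + r ≤ m) :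
    ∃ (B : Matrix (Fin m) (Fin q) ℝ) (L : Matrix (Fin q) (Fin m) ℝ), Y * B = 0 ∧ L * B = 1 := by
  have hq : q ≤ Module.finrank ℝ (LinearMap.ker Y.mulVecLin) := by
    have := Y.mulVecLin.finrank_range_add_finrank_ker
    rw [← Matrix.rank, Module.finrank_fin_fun] at this
    have := rank_le_height Y
    omega
  obtain ⟨f, hf⟩ := exists_linearIndependent_of_le_finrank hq
  have hf' := hf.map' (Submodule.subtype _) (Submodule.ker_subtype _)
  let B : Matrix (Fin m) (Fin q) ℝ := Matrix.of fun i j => (f j : Fin m → ℝ) i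
  have hB : B.rank = q := by
    rw [← rank_transpose]
    have h1 := LinearIndependent.rank_matrix (M := Bᵀ) hf'
    simpa using h1
  obtain ⟨L, hL⟩ := exists_left_inverse_of_rank_eq B hB
  refine ⟨B, L, ?_, hL⟩
  ext i j
  exact congrFun (LinearMap.mem_ker.mp (f j).2) i

/-- The columns of `U` form an orthonormal basis of the column space of `A`. -/
theorem exists_orthonormal_frame {m n r : ℕ} (A : Matrix (Fin m) (Fin n) ℝ) (h : A.rank = r) :
    ∃ U : Matrix (Fin m) (Fin r) ℝ, Uᵀ * U = 1 ∧ U * (Uᵀ * A) = A := by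
  let S : Submodule ℝ (EuclideanSpace ℝ (Fin m)) :=
    LinearMap.range (Matrix.toLpLin 2 2 A)
  have hS : Module.finrank ℝ S = r := by
    rw [← h]
    exact (A.rank_eq_finrank_range_toLin (PiLp.basisFun 2 ℝ _) (PiLp.basisFun 2 ℝ _)).symm
  let b := (stdOrthonormalBasis ℝ S).reindex (finCongr hS)
  refine ⟨Matrix.of fun i j => (b j : EuclideanSpace ℝ (Fin m)) i, ?_, ?_⟩
  · ext i j
    have := orthonormal_iff_ite.mp b.orthonormal i j
    rw [one_apply, ← this, mul_apply, Submodule.coe_inner, PiLp.inner_apply]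
    exact Finset.sum_congr rfl fun l _ => mul_comm _ _
  · ext i j
    have hx : WithLp.toLp 2 (A.col j) ∈ S := ⟨WithLp.toLp 2 (Pi.single j 1), by
      rw [Matrix.toLpLin_toLp, toLin'_apply, mulVec_single_one]⟩
    have hcoeff (l : Fin r) :
        inner ℝ (b l) ⟨_, hx⟩ = ∑ i, (b l : EuclideanSpace ℝ (Fin m)) i * A i j := by
      rw [Submodule.coe_inner, PiLp.inner_apply]
      exact Finset.sum_congr rfl fun i _ => mul_comm _ _
    have hsum := congrArg (fun x : S => (x : EuclideanSpace ℝ (Fin m)) i) (b.sum_repr ⟨_, hx⟩)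
    simp only [b.repr_apply_apply, hcoeff] at hsum
    calc _ = ∑ l, (∑ i, (b l : EuclideanSpace ℝ (Fin m)) i * A i j) *
        (b l : EuclideanSpace ℝ (Fin m)) i := by
          rw [mul_apply]
          exact Finset.sum_congr rfl fun l _ => mul_comm _ _
      _ = A i j := by
          rw [← show _ = A i j from hsum]
          simp

theorem exists_rank_factorization {m n r : ℕ} (A : Matrix (Fin m) (Fin n) ℝ) (h : A.rank = r) :
    ∃ (D : Matrix (Fin m) (Fin r) ℝ) (C : Matrix (Fin r) (Fin n) ℝ) (Y : Matrix (Fin r) (Fin m) ℝ)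
      (X : Matrix (Fin n) (Fin r) ℝ), A = D * C ∧ Y * D = 1 ∧ C * X = 1 := by
  obtain ⟨U, hU, hA⟩ := exists_orthonormal_frame A h
  have h1 := rank_mul_le_right U (Uᵀ * A)
  rw [hA, h] at h1
  obtain ⟨X, hX⟩ := exists_right_inverse_of_rank_eq (Uᵀ * A)
    (le_antisymm (rank_le_height _) h1)
  exact ⟨U, Uᵀ * A, Uᵀ, X, hA.symm, hU, hX⟩

theorem rank_mul_eq_right_iff {m k n : ℕ} (A : Matrix (Fin m) (Fin k) ℝ)
    (B : Matrix (Fin k) (Fin n) ℝ) :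
    (A * B).rank = B.rank ↔
      ∀ x : Fin k → ℝ, A.mulVec x = 0 → (∃ y : Fin n → ℝ, B.mulVec y = x) → x = 0 := by
  let f := A.mulVecLin.domRestrict (LinearMap.range B.mulVecLin)
  have hrange : LinearMap.range f = LinearMap.range (A * B).mulVecLin := by
    rw [LinearMap.range_domRestrict, mulVecLin_mul, LinearMap.range_comp]
  have hdim := f.finrank_range_add_finrank_ker
  rw [hrange, ← Matrix.rank, ← Matrix.rank] at hdim
  have h0 : (A * B).rank = B.rank ↔ LinearMap.ker f = ⊥ := by
    rw [← Submodule.finrank_eq_zero]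
    omega
  rw [h0, LinearMap.ker_eq_bot']
  constructor
  · rintro h x hx ⟨y, rfl⟩
    exact congrArg Subtype.val (h ⟨B.mulVec y, y, rfl⟩ hx)
  · rintro h ⟨_, y, rfl⟩ hx
    exact Subtype.ext (h _ hx ⟨y, rfl⟩)

theorem rank_mul_eq_left_iff {m k n : ℕ} (A : Matrix (Fin m) (Fin k) ℝ)
    (B : Matrix (Fin k) (Fin n) ℝ) :
    (A * B).rank = A.rank ↔
      ∀ x : Fin k → ℝ, Bᵀ.mulVec x = 0 → (∃ y : Fin m → ℝ, Aᵀ.mulVec y = x) → x = 0 := by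
  rw [← rank_mul_eq_right_iff, ← transpose_mul, rank_transpose, rank_transpose]

/-- If `Y` is injective on the column space of `Z * X`, then the columns of any multiple of `Z`
killed by `Y` span at most the complementary dimension. -/
theorem rank_add_le_of_mul_eq_zero {m n p r : ℕ} (Z : Matrix (Fin m) (Fin n) ℝ)
    (G : Matrix (Fin n) (Fin p) ℝ) (X : Matrix (Fin n) (Fin r) ℝ) (Y : Matrix (Fin r) (Fin m) ℝ)
    (hu : IsUnit (Y * Z * X)) (hY : Y * (Z * G) = 0) : (Z * G).rank + r ≤ Z.rank := by
  have hinj : ∀ v : Fin r → ℝ, Y.mulVec ((Z * X).mulVec v) = 0 → v = 0 := by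
    intro v hv
    rw [mulVec_mulVec, ← Matrix.mul_assoc] at hv
    exact Matrix.mulVec_injective_of_isUnit hu (by simpa using hv)
  have hr : (Z * X).rank = r := by
    have h1 := rank_mul_le_right Y (Z * X)
    rw [← Matrix.mul_assoc, rank_of_isUnit _ hu, Fintype.card_fin] at h1
    exact le_antisymm (rank_le_width _) h1
  have hdis : Disjoint (LinearMap.range (Z * G).mulVecLin)
      (LinearMap.range (Z * X).mulVecLin) := by
    rw [Submodule.disjoint_def]
    rintro _ ⟨u, hu⟩ ⟨v, rfl⟩
    have hv : v = 0 := hinj v (by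
      rw [← mulVecLin_apply (Z * X), ← hu, mulVecLin_apply, mulVec_mulVec, hY, zero_mulVec])
    simp [hv]
  have hsup := Submodule.finrank_sup_add_finrank_inf_eq (LinearMap.range (Z * G).mulVecLin)
      (LinearMap.range (Z * X).mulVecLin)
  rw [hdis.eq_bot, finrank_bot, ← Matrix.rank, ← Matrix.rank, hr, add_zero] at hsup
  rw [← hsup]
  refine Submodule.finrank_mono (sup_le ?_ ?_)
  · rw [mulVecLin_mul]; exact LinearMap.range_comp_le_range _ _
  · rw [mulVecLin_mul]; exact LinearMap.range_comp_le_range _ _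

/-- Simultaneous normal form of a pair of matrices of rank `r` whose product has rank `r`. -/
theorem exists_normal_form {m k n r : ℕ} (W1 : Matrix (Fin m) (Fin k) ℝ)
    (W2 : Matrix (Fin k) (Fin n) ℝ) (h1 : W1.rank = r) (h2 : W2.rank = r)
    (h : (W1 * W2).rank = r) :
    ∃ (D : Matrix (Fin m) (Fin r) ℝ) (Y : Matrix (Fin r) (Fin m) ℝ)
      (C : Matrix (Fin r) (Fin n) ℝ) (X : Matrix (Fin n) (Fin r) ℝ)
      (P : Matrix (Fin k) (Fin r) ℝ) (Q : Matrix (Fin r) (Fin k) ℝ)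
      (P' : Matrix (Fin k) (Fin (k - r)) ℝ) (Q' : Matrix (Fin (k - r)) (Fin k) ℝ),
      W1 = D * Q ∧ W2 = P * C ∧ Y * D = 1 ∧ C * X = 1 ∧ Q * P = 1 ∧ Q * P' = 0 ∧ Q' * P = 0 ∧
        Q' * P' = 1 ∧ P * Q + P' * Q' = 1 := by
  have hrk : r ≤ k := h1 ▸ rank_le_width W1
  obtain ⟨D, Q, Y, -, hW1, hYD, -⟩ := exists_rank_factorization W1 h1
  obtain ⟨P₀, C₀, -, X₀, hW2, -, hCX⟩ := exists_rank_factorization W2 h2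
  have hT : W1 * W2 = D * (Q * P₀) * C₀ := by rw [hW1, hW2]; simp only [Matrix.mul_assoc]
  have hr : (Q * P₀).rank = r := by
    have h3 := (rank_mul_le_left (D * (Q * P₀)) C₀).trans (rank_mul_le_right D (Q * P₀))
    rw [← hT, h] at h3
    exact le_antisymm (rank_le_width _) h3
  obtain ⟨L, hL⟩ := exists_left_inverse_of_rank_eq _ hr
  have hL' : Q * P₀ * L = 1 := mul_eq_one_comm.mp hL
  obtain ⟨P', L', hQP', hLP'⟩ := exists_frame_in_ker (q := k - r) Q (by omega)
  have hQP : Q * (P₀ * L) = 1 := by rw [← Matrix.mul_assoc, hL']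
  have e1 : L' * (1 - P₀ * L * Q) * (P₀ * L) = 0 := by
    rw [Matrix.mul_assoc, Matrix.sub_mul, Matrix.mul_assoc (P₀ * L), hQP]; simp
  have e2 : L' * (1 - P₀ * L * Q) * P' = 1 := by
    rw [Matrix.mul_assoc, Matrix.sub_mul, Matrix.mul_assoc (P₀ * L), hQP']; simpa
  refine ⟨D, Y, Q * P₀ * C₀, X₀ * L, P₀ * L, Q, P', L' * (1 - P₀ * L * Q), hW1, ?_, hYD, ?_, hQP,
    hQP', e1, e2, ?_⟩
  · rw [hW2, show P₀ * L * (Q * P₀ * C₀) = P₀ * (L * (Q * P₀)) * C₀ by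
      simp only [Matrix.mul_assoc], hL, Matrix.mul_one]
  · rw [show Q * P₀ * C₀ * (X₀ * L) = Q * P₀ * (C₀ * X₀) * L by
      simp only [Matrix.mul_assoc], hCX, Matrix.mul_one, hL']
  · rw [← fromCols_mul_fromRows, fromCols_mul_fromRows_eq_one_comm
      ((finCongr (by omega)).trans finSumFinEquiv.symm), fromRows_mul_fromCols, hQP, hQP', e1, e2, fromBlocks_one]

theorem exists_add_full_rank {m k n : ℕ} (hkm : k ≤ m) (W1 : Matrix (Fin m) (Fin k) ℝ)
    (W2 : Matrix (Fin k) (Fin n) ℝ) (hrank : W1.rank = W2.rank)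
    (h : (W1 * W2).rank = W2.rank) :
    ∃ W1' : Matrix (Fin m) (Fin k) ℝ, W1' * W2 = 0 ∧ (W1 + W1').rank = k := by
  have hrk : W2.rank ≤ k := rank_le_height W2
  obtain ⟨D, Y, C, X, P, Q, P', Q', hW1, hW2, hYD, -, -, -, hQPzero, -, hsum⟩ :=
    exists_normal_form W1 W2 hrank rfl h
  obtain ⟨D', L, hYD', hLD'⟩ := exists_frame_in_ker (q := k - W2.rank) Y (by omega)
  refine ⟨D' * Q', ?_, rank_eq_of_mul_eq_one (L := P * Y + P' * (L * (1 - D * Y))) ?_⟩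
  · calc D' * Q' * W2 = D' * (Q' * P) * C := by
          conv_lhs => rhs; rw [hW2]
          simp only [Matrix.mul_assoc]
      _ = 0 := by rw [hQPzero]; simp
  · have e1 : (P * Y + P' * (L * (1 - D * Y))) * D = P := by
      simp [Matrix.add_mul, Matrix.mul_assoc, Matrix.sub_mul, hYD]
    have e2 : (P * Y + P' * (L * (1 - D * Y))) * D' = P' := by
      simp [Matrix.add_mul, Matrix.mul_assoc, Matrix.sub_mul, hYD', hLD']
    rw [hW1, Matrix.mul_add, ← Matrix.mul_assoc _ D, ← Matrix.mul_assoc _ D', e1, e2, hsum]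

theorem rank_mul_eq_right_of_add_full_rank {m k n : ℕ} {W1 W1' : Matrix (Fin m) (Fin k) ℝ}
    {W2 : Matrix (Fin k) (Fin n) ℝ} (h0 : W1' * W2 = 0) (h : (W1 + W1').rank = k) :
    (W1 * W2).rank = W2.rank := by
  obtain ⟨L, hL⟩ := exists_left_inverse_of_rank_eq _ h
  have h1 : L * (W1 * W2) = W2 := by
    rw [← add_zero (W1 * W2), ← h0, ← Matrix.add_mul, ← Matrix.mul_assoc, hL, Matrix.one_mul]
  exact le_antisymm (rank_mul_le_right _ _) (by simpa [h1] using rank_mul_le_right L (W1 * W2))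

section Frobenius

attribute [local instance] Matrix.frobeniusNormedAddCommGroup Matrix.frobeniusNormedSpace

theorem frob_eq_norm {m n : ℕ} (A : Matrix (Fin m) (Fin n) ℝ) : frob A = ‖A‖ := by
  rw [frob, Matrix.frobenius_norm_def, Real.sqrt_eq_rpow]
  simp

theorem nhds_hasBasis_frob {m n : ℕ} (A : Matrix (Fin m) (Fin n) ℝ) :
    (nhds A).HasBasis (0 < ·) fun ε => {B | frob (B - A) < ε} := by
  simp only [frob_eq_norm, ← dist_eq_norm]
  exact Metric.nhds_basis_ball

theorem frob_mul_le {m k n : ℕ} (A : Matrix (Fin m) (Fin k) ℝ) (B : Matrix (Fin k) (Fin n) ℝ) :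
    frob (A * B) ≤ frob A * frob B := by
  simpa only [frob_eq_norm] using Matrix.frobenius_norm_mul A B

theorem frob_smul {m n : ℕ} (c : ℝ) (A : Matrix (Fin m) (Fin n) ℝ) :
    frob (c • A) = |c| * frob A := by
  rw [frob_eq_norm, frob_eq_norm, norm_smul, Real.norm_eq_abs]

end Frobenius

theorem frob_transpose {m n : ℕ} (A : Matrix (Fin m) (Fin n) ℝ) : frob Aᵀ = frob A := by
  rw [frob, frob, Finset.sum_comm]
  rfl

theorem frob_nonneg {m n : ℕ} (A : Matrix (Fin m) (Fin n) ℝ) : 0 ≤ frob A := Real.sqrt_nonneg _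

theorem frob_of_transpose_mul_eq_one {m r : ℕ} {A : Matrix (Fin m) (Fin r) ℝ}
    (h : Aᵀ * A = 1) : frob A = Real.sqrt r := by
  have htr := congrArg Matrix.trace h
  rw [trace_one, Fintype.card_fin] at htr
  rw [frob, ← htr, Finset.sum_comm]
  simp [Matrix.trace, mul_apply, pow_two]

theorem mulLocOpenAt_iff_eventually {m k n : ℕ} (hk : k < min m n)
    (W1 : Matrix (Fin m) (Fin k) ℝ) (W2 : Matrix (Fin k) (Fin n) ℝ) :
    MulLocOpenAt W1 W2 ↔ ∀ U ∈ nhds W1, ∀ V ∈ nhds W2, ∀ᶠ Z in nhds (W1 * W2),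
      Z.rank ≤ k → ∃ V1 ∈ U, ∃ V2 ∈ V, V1 * V2 = Z := by
  have hmin : min m (min n k) = k := by omega
  rw [MulLocOpenAt, hmin]
  constructor
  · intro h U hU V hV
    obtain ⟨ε, hε, hεU⟩ := (nhds_hasBasis_frob W1).mem_iff.mp hU
    obtain ⟨η, hη, hηV⟩ := (nhds_hasBasis_frob W2).mem_iff.mp hV
    obtain ⟨δ, hδ, hZ⟩ := h (min ε η) (lt_min hε hη)
    refine (nhds_hasBasis_frob _).eventually_iff.mpr ⟨δ, hδ, fun Z hZδ hr => ?_⟩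
    obtain ⟨V1, V2, hV1, hV2, rfl⟩ := hZ Z hr hZδ
    exact ⟨V1, hεU (hV1.trans_le (min_le_left _ _)), V2, hηV (hV2.trans_le (min_le_right _ _)), rfl⟩
  · intro h ε hε
    obtain ⟨δ, hδ, hZ⟩ := (nhds_hasBasis_frob _).eventually_iff.mp
      (h _ ((nhds_hasBasis_frob W1).mem_of_mem hε) _ ((nhds_hasBasis_frob W2).mem_of_mem hε))
    refine ⟨δ, hδ, fun Z hr hZδ => ?_⟩
    obtain ⟨V1, hV1, V2, hV2, rfl⟩ := hZ hZδ hr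
    exact ⟨V1, V2, hV1, hV2, rfl⟩

theorem MulLocOpenAt.transpose {m k n : ℕ} {W1 : Matrix (Fin m) (Fin k) ℝ}
    {W2 : Matrix (Fin k) (Fin n) ℝ} (h : MulLocOpenAt W1 W2) : MulLocOpenAt W2ᵀ W1ᵀ := by
  intro ε hε
  obtain ⟨δ, hδ, hZ⟩ := h ε hε
  refine ⟨δ, hδ, fun Z hr hZδ => ?_⟩
  obtain ⟨V1, V2, hV1, hV2, h12⟩ := hZ Zᵀ (by rw [rank_transpose]; omega) (by
    rwa [← frob_transpose, transpose_sub, transpose_transpose, transpose_mul])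
  refine ⟨V2ᵀ, V1ᵀ, ?_, ?_, by rw [← transpose_mul, h12, transpose_transpose]⟩
  · rwa [← transpose_sub, frob_transpose]
  · rwa [← transpose_sub, frob_transpose]

theorem eventually_isUnit_add_smul_one {k : ℕ} (M : Matrix (Fin k) (Fin k) ℝ) :
    ∀ᶠ t : ℝ in nhdsWithin 0 {0}ᶜ, IsUnit (M + t • 1) := by
  have hfin : {t : ℝ | ¬ IsUnit (M + t • 1)}.Finite := by
    refine (Polynomial.finite_setOfPred_isRoot (Matrix.charpoly_monic (-M)).ne_zero).subset ?_
    intro t ht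
    rw [Set.mem_ofPred_eq, Matrix.isUnit_iff_isUnit_det, isUnit_iff_ne_zero, not_not] at ht
    rw [Set.mem_ofPred_eq, Polynomial.IsRoot.def, Matrix.eval_charpoly, ← ht, sub_neg_eq_add,
      add_comm, Matrix.smul_one_eq_diagonal]
    rfl
  exact (Filter.eventually_cofinite.mpr hfin).filter_mono (nhdsNE_le_cofinite 0)

theorem MulLocOpenAt.rank_mul_eq_left {m k n : ℕ} (hk : k < min m n)
    {W1 : Matrix (Fin m) (Fin k) ℝ} {W2 : Matrix (Fin k) (Fin n) ℝ} (h : MulLocOpenAt W1 W2) :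
    (W1 * W2).rank = W1.rank := by
  rw [rank_mul_eq_left_iff]
  rintro _ hx ⟨y, rfl⟩
  by_contra hne
  let u : Matrix (Fin 1) (Fin m) ℝ := Matrix.replicateRow (Fin 1) y
  have hu1 : u * W1 ≠ 0 := fun h0 => hne <| by
    ext j
    simpa [u, mul_apply, mulVec, dotProduct, mul_comm] using congrFun (congrFun h0 0) j
  have hu12 : u * (W1 * W2) = 0 := by
    rw [mulVec_mulVec, ← transpose_mul] at hx
    ext i j
    simpa [u, mul_apply, mulVec, dotProduct, mul_comm] using congrFun hx j
  have hurank : u.rank = 1 := by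
    refine le_antisymm (rank_le_height u) (Nat.one_le_iff_ne_zero.mpr fun h0 => hu1 ?_)
    have hu : u = 0 := by
      rw [Matrix.rank, Submodule.finrank_eq_zero, LinearMap.range_eq_bot] at h0
      exact Matrix.toLin'.map_eq_zero_iff.mp h0
    rw [hu, Matrix.zero_mul]
  obtain ⟨c, hc⟩ := exists_right_inverse_of_rank_eq u hurank
  obtain ⟨B, L, huB, hLB⟩ := exists_frame_in_ker (q := k) u (by omega)
  obtain ⟨B', X', -, hXB'⟩ :=
    exists_frame_in_ker (q := k) (0 : Matrix (Fin 0) (Fin n) ℝ) (by omega)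
  have hBX : B'ᵀ * X'ᵀ = 1 := by rw [← transpose_mul, hXB', transpose_one]
  let P := W1 - c * (u * W1)
  have huP : u * P = 0 := by
    rw [Matrix.mul_sub, ← Matrix.mul_assoc u c, hc, Matrix.one_mul, sub_self]
  have hPW : P * W2 = W1 * W2 := by
    rw [Matrix.sub_mul, Matrix.mul_assoc c, Matrix.mul_assoc u, hu12, Matrix.mul_zero, sub_zero]
  let Z : ℝ → Matrix (Fin m) (Fin n) ℝ := fun t => (P + t • B) * (W2 + t • B'ᵀ)
  have hZ : Filter.Tendsto Z (nhdsWithin 0 {0}ᶜ) (nhds (W1 * W2)) := by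
    have hcont : Continuous Z := by fun_prop
    have h0 : Z 0 = W1 * W2 := by simp [Z, hPW]
    exact h0 ▸ (hcont.tendsto 0).mono_left nhdsWithin_le_nhds
  have hU : {V : Matrix (Fin m) (Fin k) ℝ | u * V ≠ 0} ∈ nhds W1 :=
    (isOpen_ne_fun (by fun_prop) continuous_const).mem_nhds hu1
  have hev := hZ.eventually
    ((mulLocOpenAt_iff_eventually hk W1 W2).mp h _ hU _ Filter.univ_mem)
  obtain ⟨t, ht, hP, hW⟩ := (hev.and ((eventually_isUnit_add_smul_one (L * P)).and
    (eventually_isUnit_add_smul_one (W2 * X'ᵀ)))).exists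
  obtain ⟨V1, hV1, V2, -, hV⟩ :=
    ht ((rank_mul_le_left _ _).trans (rank_le_width _))
  have hunit : IsUnit ((L * V1) * (V2 * X'ᵀ)) := by
    have : (L * V1) * (V2 * X'ᵀ) = (L * P + t • 1) * (W2 * X'ᵀ + t • 1) := by
      calc (L * V1) * (V2 * X'ᵀ) = L * (V1 * V2) * X'ᵀ := by simp only [Matrix.mul_assoc]
        _ = (L * (P + t • B)) * ((W2 + t • B'ᵀ) * X'ᵀ) := by
          rw [hV]; simp only [Z, Matrix.mul_assoc]
        _ = _ := by
          rw [Matrix.mul_add L, Matrix.add_mul W2, Matrix.mul_smul, Matrix.smul_mul, hLB, hBX]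
    rw [this]
    exact hP.mul hW
  have hunit2 : IsUnit (V2 * X'ᵀ) := by
    rw [Matrix.isUnit_iff_isUnit_det, det_mul] at hunit
    exact (Matrix.isUnit_iff_isUnit_det _).mpr (isUnit_of_mul_isUnit_right hunit)
  obtain ⟨R, hR⟩ := hunit2.exists_right_inv
  refine hV1 ?_
  calc u * V1 = u * (V1 * V2) * X'ᵀ * R := by
        rw [← Matrix.mul_one (u * V1), ← hR]
        simp only [Matrix.mul_assoc]
    _ = 0 := by
        have huZ : u * (P + t • B) = 0 := by
          rw [Matrix.mul_add, Matrix.mul_smul, huB, huP, smul_zero, add_zero]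
        rw [hV, ← Matrix.mul_assoc u, huZ]
        simp only [Matrix.zero_mul]

/-- Matrix multiplication is locally open at the origin relative to the matrices whose rank is at
most the inner dimension. -/
theorem eventually_exists_small_factors {m q n : ℕ} {U : Set (Matrix (Fin m) (Fin q) ℝ)}
    {V : Set (Matrix (Fin q) (Fin n) ℝ)} (hU : U ∈ nhds 0) (hV : V ∈ nhds 0) :
    ∀ᶠ E : Matrix (Fin m) (Fin n) ℝ in nhds 0, E.rank ≤ q → ∃ e₁ ∈ U, ∃ e₂ ∈ V, e₁ * e₂ = E := by
  obtain ⟨ε, hε, hεU⟩ := (nhds_hasBasis_frob 0).mem_iff.mp hU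
  obtain ⟨η, hη, hηV⟩ := (nhds_hasBasis_frob 0).mem_iff.mp hV
  have hq : (0 : ℝ) < q + 1 := by positivity
  let s : ℝ := ε / (q + 1)
  have hs : 0 < s := div_pos hε hq
  refine (nhds_hasBasis_frob 0).eventually_iff.mpr ⟨η * s / (q + 1), by positivity, ?_⟩
  intro E hE hr
  rw [Set.mem_ofPred_eq, sub_zero] at hE
  obtain ⟨F, hFq, hF⟩ : ∃ F : Matrix (Fin m) (Fin q) ℝ, frob F ≤ q ∧ F * (Fᵀ * E) = E := by
    obtain ⟨F₀, hF₀, hE₀⟩ := exists_orthonormal_frame E rfl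
    let J : Matrix (Fin E.rank) (Fin q) ℝ := (1 : Matrix (Fin q) (Fin q) ℝ).submatrix
      (Fin.castLE hr) id
    have hJ : J * Jᵀ = 1 := by
      ext i j
      simp [J, mul_apply, one_apply]
    refine ⟨F₀ * J, ?_, ?_⟩
    · have hJn : frob J = Real.sqrt E.rank := by
        rw [← frob_transpose]
        exact frob_of_transpose_mul_eq_one (by rwa [transpose_transpose])
      refine (frob_mul_le _ _).trans ?_
      rw [frob_of_transpose_mul_eq_one hF₀, hJn, Real.mul_self_sqrt (Nat.cast_nonneg _)]
      exact_mod_cast hr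
    · calc F₀ * J * ((F₀ * J)ᵀ * E) = F₀ * (J * Jᵀ) * (F₀ᵀ * E) := by
            rw [transpose_mul]; simp only [Matrix.mul_assoc]
        _ = E := by rw [hJ, Matrix.mul_one, hE₀]
  refine ⟨s • F, hεU ?_, s⁻¹ • (Fᵀ * E), hηV ?_, ?_⟩
  · rw [Set.mem_ofPred_eq, sub_zero, frob_smul, abs_of_pos hs]
    calc s * frob F ≤ s * q := by gcongr
      _ < s * (q + 1) := by gcongr; linarith
      _ = ε := div_mul_cancel₀ _ hq.ne'
  · rw [Set.mem_ofPred_eq, sub_zero, frob_smul, abs_of_pos (inv_pos.mpr hs)]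
    calc s⁻¹ * frob (Fᵀ * E) ≤ s⁻¹ * (q * frob E) := by
          gcongr
          refine (frob_mul_le _ _).trans ?_
          rw [frob_transpose]
          exact mul_le_mul_of_nonneg_right hFq (frob_nonneg E)
      _ ≤ s⁻¹ * ((q + 1) * frob E) := by
          have := frob_nonneg E
          gcongr
          linarith
      _ < s⁻¹ * ((q + 1) * (η * s / (q + 1))) := by gcongr
      _ = η := by field_simp
  · rw [Matrix.smul_mul, Matrix.mul_smul, smul_smul, mul_inv_cancel₀ hs.ne', one_smul, hF]

theorem mulLocOpenAt_of_rank_mul_eq {m k n : ℕ} (hk : k < min m n)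
    {W1 : Matrix (Fin m) (Fin k) ℝ} {W2 : Matrix (Fin k) (Fin n) ℝ} (hrank : W1.rank = W2.rank)
    (h : (W1 * W2).rank = W2.rank) : MulLocOpenAt W1 W2 := by
  rw [mulLocOpenAt_iff_eventually hk]
  intro U hU V hV
  obtain ⟨r, hr⟩ : ∃ r, W2.rank = r := ⟨_, rfl⟩
  rw [hr] at h hrank
  have hrk : r ≤ k := hr ▸ rank_le_height W2
  obtain ⟨D, Y, C, X, P, Q, P', Q', hW1, hW2, hYD, hCX, hQP, hQP', hQPzero, hQPone, -⟩ :=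
    exists_normal_form W1 W2 hrank hr h
  have hT : W1 * W2 = D * C := by
    rw [hW1, hW2, Matrix.mul_assoc, ← Matrix.mul_assoc Q, hQP, Matrix.one_mul]
  rw [hT]
  have hN : Y * (D * C) * X = 1 := by
    rw [← Matrix.mul_assoc, hYD, Matrix.one_mul, hCX]
  have hinv : Filter.Tendsto (fun Z => (Y * Z * X)⁻¹) (nhds (D * C)) (nhds 1) := by
    have h1 : ContinuousAt Inv.inv (1 : Matrix (Fin r) (Fin r) ℝ) :=
      continuousAt_matrix_inv 1 (by
        rw [det_one]
        exact NormedRing.inverse_continuousAt (1 : ℝˣ))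
    have h2 : Filter.Tendsto (fun Z => Y * Z * X) (nhds (D * C)) (nhds 1) := by
      rw [← hN]
      exact Continuous.tendsto (by fun_prop) _
    have h3 := h1.tendsto.comp h2
    rwa [inv_one] at h3
  have hid : Filter.Tendsto (fun Z => Z) (nhds (D * C)) (nhds (D * C)) := Filter.tendsto_id
  have hZX : Filter.Tendsto (fun Z => Z * X * (Y * Z * X)⁻¹) (nhds (D * C)) (nhds D) := by
    have hlim : D * C * X * (1 : Matrix (Fin r) (Fin r) ℝ) = D := by
      rw [Matrix.mul_one, Matrix.mul_assoc, hCX, Matrix.mul_one]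
    have hpair :=
      (Continuous.tendsto (f := fun Z => Z * X) (by fun_prop) (D * C)).prodMk_nhds hinv
    have hmul : Continuous fun p : Matrix (Fin m) (Fin r) ℝ × Matrix (Fin r) (Fin r) ℝ =>
      p.1 * p.2 := by fun_prop
    have hcomp := (hmul.tendsto _).comp hpair
    rwa [hlim] at hcomp
  have hV1 : Filter.Tendsto (fun p : Matrix (Fin m) (Fin n) ℝ × Matrix (Fin m) (Fin (k - r)) ℝ =>
      p.1 * X * (Y * p.1 * X)⁻¹ * Q + p.2 * Q') (nhds (D * C) ×ˢ nhds 0) (nhds W1) := by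
    have hc : Continuous fun p : Matrix (Fin m) (Fin r) ℝ × Matrix (Fin m) (Fin (k - r)) ℝ =>
      p.1 * Q + p.2 * Q' := by fun_prop
    have := (hc.tendsto (D, 0)).comp
      ((hZX.comp Filter.tendsto_fst).prodMk_nhds Filter.tendsto_snd)
    simp only [Matrix.zero_mul, add_zero, ← hW1] at this
    exact this
  have hV2 : Filter.Tendsto (fun p : Matrix (Fin m) (Fin n) ℝ × Matrix (Fin (k - r)) (Fin n) ℝ =>
      P * (Y * p.1) + P' * p.2) (nhds (D * C) ×ˢ nhds 0) (nhds W2) := by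
    have hc : Continuous fun p : Matrix (Fin m) (Fin n) ℝ × Matrix (Fin (k - r)) (Fin n) ℝ =>
      P * (Y * p.1) + P' * p.2 := by fun_prop
    have hlim : P * (Y * (D * C)) + P' * (0 : Matrix (Fin (k - r)) (Fin n) ℝ) = W2 := by
      rw [← Matrix.mul_assoc Y, hYD, Matrix.one_mul, hW2, Matrix.mul_zero, add_zero]
    rw [← nhds_prod_eq, ← hlim]
    exact hc.tendsto (D * C, 0)
  have hE : Filter.Tendsto (fun Z => Z - Z * X * (Y * Z * X)⁻¹ * (Y * Z)) (nhds (D * C))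
      (nhds 0) := by
    have hc : Continuous fun p : Matrix (Fin m) (Fin n) ℝ × Matrix (Fin m) (Fin r) ℝ =>
      p.1 - p.2 * (Y * p.1) := by fun_prop
    have := (hc.tendsto (D * C, D)).comp (hid.prodMk_nhds hZX)
    have hlim : D * C - D * (Y * (D * C)) = 0 := by
      rw [← Matrix.mul_assoc Y, hYD, Matrix.one_mul, sub_self]
    rwa [hlim] at this
  have hunit : ∀ᶠ Z in nhds (D * C), IsUnit (Y * Z * X) := by
    have hc : Continuous fun Z : Matrix (Fin m) (Fin n) ℝ => (Y * Z * X).det := by fun_prop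
    have hne := hc.continuousAt.eventually_ne (x := D * C) (y := 0) (by rw [hN]; simp)
    filter_upwards [hne] with Z hZ
    exact (Matrix.isUnit_iff_isUnit_det _).mpr (isUnit_iff_ne_zero.mpr hZ)
  obtain ⟨A₁, hA₁, U', hU', hAU⟩ := Filter.mem_prod_iff.mp (hV1 hU)
  obtain ⟨A₂, hA₂, V', hV', hAV⟩ := Filter.mem_prod_iff.mp (hV2 hV)
  filter_upwards [hA₁, hA₂, hunit, hE.eventually (eventually_exists_small_factors hU' hV')]
    with Z hZ₁ hZ₂ hZu hZE hZr
  have hNdet := (Matrix.isUnit_iff_isUnit_det _).mp hZu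
  have hG : Z - Z * X * (Y * Z * X)⁻¹ * (Y * Z) =
      Z * (1 - X * (Y * Z * X)⁻¹ * (Y * Z)) := by
    rw [Matrix.mul_sub, Matrix.mul_one]
    simp only [Matrix.mul_assoc]
  have hYE : Y * (Z - Z * X * (Y * Z * X)⁻¹ * (Y * Z)) = 0 := by
    have : Y * (Z * X * (Y * Z * X)⁻¹ * (Y * Z)) = (Y * Z * X) * (Y * Z * X)⁻¹ * (Y * Z) := by
      simp only [Matrix.mul_assoc]
    rw [Matrix.mul_sub, this, Matrix.mul_nonsing_inv _ hNdet, Matrix.one_mul, sub_self]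
  obtain ⟨e₁, he₁, e₂, he₂, he⟩ := hZE (by
    rw [hG] at hYE ⊢
    have := rank_add_le_of_mul_eq_zero Z _ X Y hZu hYE
    omega)
  refine ⟨_, hAU (Set.mk_mem_prod hZ₁ he₁), _, hAV (Set.mk_mem_prod hZ₂ he₂), ?_⟩
  dsimp only
  generalize hR : Z * X * (Y * Z * X)⁻¹ = R at he ⊢
  calc (R * Q + e₁ * Q') * (P * (Y * Z) + P' * e₂)
      = R * (Q * P) * (Y * Z) + R * (Q * P') * e₂ + e₁ * (Q' * P) * (Y * Z)
        + e₁ * (Q' * P') * e₂ := by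
        simp only [Matrix.add_mul, Matrix.mul_add, Matrix.mul_assoc]
        abel
    _ = Z := by
        rw [hQP, hQP', hQPzero, hQPone, Matrix.mul_one, Matrix.mul_one, he]
        simp

/-- Complete characterization of local openness of matrix multiplication in its
range in the rank-deficient case `k < min m n`. -/
theorem statement_1 {m k n : ℕ} (hk : k < min m n)
    (W1 : Matrix (Fin m) (Fin k) ℝ) (W2 : Matrix (Fin k) (Fin n) ℝ) :
    (W1.rank ≠ W2.rank → ¬ MulLocOpenAt W1 W2) ∧
    (W1.rank = W2.rank →
      [(∃ W1' : Matrix (Fin m) (Fin k) ℝ, W1' * W2 = 0 ∧ (W1 + W1').rank = k),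
       (∃ W2' : Matrix (Fin k) (Fin n) ℝ, W1 * W2' = 0 ∧ (W2 + W2').rank = k),
       (∀ x : Fin k → ℝ, W1.mulVec x = 0 → (∃ y : Fin n → ℝ, W2.mulVec y = x) → x = 0),
       (∀ x : Fin k → ℝ, W2ᵀ.mulVec x = 0 → (∃ y : Fin m → ℝ, W1ᵀ.mulVec y = x) → x = 0),
       MulLocOpenAt W1 W2].TFAE) := by
  refine ⟨fun hne hopen => hne ?_, fun hrank => ?_⟩
  · have h1 := hopen.rank_mul_eq_left hk
    have h2 := hopen.transpose.rank_mul_eq_left (by omega)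
    rw [← transpose_mul, rank_transpose, rank_transpose] at h2
    rw [← h1, h2]
  · have hiff := rank_mul_eq_right_iff W1 W2
    tfae_have 1 → 3 := fun ⟨W1', h0, hfull⟩ =>
      hiff.mp (rank_mul_eq_right_of_add_full_rank h0 hfull)
    tfae_have 3 → 1 := fun h => exists_add_full_rank (by omega) W1 W2 hrank (hiff.mpr h)
    tfae_have 3 ↔ 4 := by rw [← hiff, ← rank_mul_eq_left_iff, hrank]
    tfae_have 2 → 4 := fun ⟨W2', h0, hfull⟩ => by
      rw [← rank_mul_eq_left_iff, ← rank_transpose, transpose_mul, ← rank_transpose W1]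
      refine rank_mul_eq_right_of_add_full_rank (W1' := W2'ᵀ) ?_ ?_
      · rw [← transpose_mul, h0, transpose_zero]
      · rw [← transpose_add, rank_transpose, hfull]
    tfae_have 4 → 2 := fun h => by
      rw [← rank_mul_eq_left_iff] at h
      obtain ⟨V, hV, hfull⟩ := exists_add_full_rank (by omega) W2ᵀ W1ᵀ
        (by rw [rank_transpose, rank_transpose, hrank])
        (by rw [← transpose_mul, rank_transpose, rank_transpose, h])
      refine ⟨Vᵀ, ?_, ?_⟩
      · rw [← transpose_transpose W1, ← transpose_mul, hV, transpose_zero]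
      · rwa [← rank_transpose, transpose_add, transpose_transpose]
    tfae_have 3 → 5 := fun h => mulLocOpenAt_of_rank_mul_eq hk hrank (hiff.mpr h)
    tfae_have 5 → 3 := fun h => hiff.mp ((h.rank_mul_eq_left hk).trans hrank)
    tfae_finish
end

section
/- Consider the pyramidal network training problem min over W = (W_h, …, W_1), Wᵢ ∈ ℝ^{dᵢ×d_{i−1}}, of ℓ(F_h(W)), where F_1(W) = σ_1(W_1·X), F_k(W) = σ_k(W_k·F_{k−1}(W)) for k = 2, …, h, each σᵢ : ℝ → ℝ is continuous and strictly monotone (applied entrywise), ℓ is convex, X ∈ ℝ^{d0×n} has full column rank (so d0 ≥ n), and the network is pyramidal, i.e., dᵢ ≤ d_{i−1} for all i = 1, …, h. If W̄ is a local minimum of this problem such that every W̄ᵢ has full row rank, then W̄ is a global minimum, i.e., ℓ(F_h(W̄)) ≤ ℓ(F_h(W)) for all W. -/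
open Matrix

/-- The feedforward network mapping: `netF d σ X W 0 = X` and
`netF d σ X W (p+1) = σ_{p+1} (W_{p+1} ⬝ netF d σ X W p)` (the weight of layer `p+1` is `W p`,
its activation is `σ (p+1)`, applied entrywise).  Thus `netF d σ X W h` is the paper's `F_h(W)`. -/
noncomputable def netF {n : ℕ} (d : ℕ → ℕ) (σ : ℕ → ℝ → ℝ)
    (X : Matrix (Fin (d 0)) (Fin n) ℝ)
    (W : (i : ℕ) → Matrix (Fin (d (i + 1))) (Fin (d i)) ℝ) :
    (p : ℕ) → Matrix (Fin (d p)) (Fin n) ℝ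
  | 0 => X
  | (p + 1) => (W p * netF d σ X W p).map (σ (p + 1))

theorem StrictMono.isOpenMap_of_continuous_real {f : ℝ → ℝ} (hf : StrictMono f)
    (hc : Continuous f) : IsOpenMap f := by
  rw [isOpenMap_iff_nhds_le]
  intro x s hs
  obtain ⟨δ, hδ, hsub⟩ := Metric.nhds_basis_closedBall.mem_iff.mp (Filter.mem_map.mp hs)
  rw [Real.closedBall_eq_Icc] at hsub
  refine Filter.mem_of_superset
    (Icc_mem_nhds (hf (sub_lt_self x hδ)) (hf (lt_add_of_pos_right x hδ))) fun y hy => ?_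
  obtain ⟨z, hz, rfl⟩ := intermediate_value_Icc (by linarith) hc.continuousOn hy
  exact hsub hz

theorem StrictAnti.isOpenMap_of_continuous_real {f : ℝ → ℝ} (hf : StrictAnti f)
    (hc : Continuous f) : IsOpenMap f := by
  have key := (Homeomorph.neg ℝ).isOpenMap.comp
    (StrictMono.isOpenMap_of_continuous_real hf.neg hc.neg)
  simpa [Function.comp_def] using key

theorem Matrix.isOpenMap_map {m n : Type*} [Finite m] [Finite n] {f : ℝ → ℝ}
    (hf : IsOpenMap f) : IsOpenMap fun A : Matrix m n ℝ => A.map f := by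
  have hrow : IsOpenMap (Pi.map fun _ : n => f) :=
    IsOpenMap.piMap (fun _ => hf) (by simp)
  exact IsOpenMap.piMap (fun _ : m => hrow) (by simp)

theorem Matrix.exists_right_inverse_of_rank {l m : ℕ} {A : Matrix (Fin l) (Fin m) ℝ}
    (hA : A.rank = l) : ∃ R : Matrix (Fin m) (Fin l) ℝ, A * R = 1 := by
  rw [← Matrix.mulVec_surjective_iff_exists_right_inverse]
  have : LinearMap.range A.mulVecLin = ⊤ :=
    Submodule.eq_top_of_finrank_eq (by simpa [Matrix.rank] using hA)
  exact LinearMap.range_eq_top.mp this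

theorem Matrix.isOpenMap_mul_left_of_rank {l m n : ℕ} {A : Matrix (Fin l) (Fin m) ℝ}
    (hA : A.rank = l) : IsOpenMap fun B : Matrix (Fin m) (Fin n) ℝ => A * B := by
  obtain ⟨R, hR⟩ := Matrix.exists_right_inverse_of_rank hA
  refine (mulLeftLinearMap (Fin n) ℝ A).isOpenMap_of_finiteDimensional fun C => ⟨R * C, ?_⟩
  simp [← Matrix.mul_assoc, hR]

theorem Matrix.isOpenMap_mul_right_of_rank {l m n : ℕ} {B : Matrix (Fin m) (Fin n) ℝ}
    (hB : B.rank = n) : IsOpenMap fun A : Matrix (Fin l) (Fin m) ℝ => A * B := by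
  obtain ⟨R, hR⟩ := Matrix.exists_right_inverse_of_rank (A := Bᵀ) (by rw [rank_transpose, hB])
  have hL : Rᵀ * B = 1 := by simpa using congrArg transpose hR
  refine (mulRightLinearMap (Fin l) ℝ B).isOpenMap_of_finiteDimensional fun C => ⟨C * Rᵀ, ?_⟩
  simp [Matrix.mul_assoc, hL]

theorem isOpenMap_netF_update_first {n h : ℕ} {d : ℕ → ℕ} {σ : ℕ → ℝ → ℝ}
    {X : Matrix (Fin (d 0)) (Fin n) ℝ} (hX : X.rank = n)
    (hσ : ∀ i, 1 ≤ i → i ≤ h → IsOpenMap (σ i))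
    {W₀ : (i : ℕ) → Matrix (Fin (d (i + 1))) (Fin (d i)) ℝ}
    (hrank : ∀ i < h, (W₀ i).rank = d (i + 1)) (p : ℕ) (hp : p < h) :
    IsOpenMap fun A => netF d σ X (Function.update W₀ 0 A) (p + 1) := by
  have hmap : IsOpenMap fun A : Matrix (Fin (d (p + 1))) (Fin n) ℝ => A.map (σ (p + 1)) :=
    Matrix.isOpenMap_map (hσ (p + 1) (by lia) (by lia))
  induction p with
  | zero =>
    have key := hmap.comp (Matrix.isOpenMap_mul_right_of_rank hX)
    simpa [netF, Function.comp_def] using key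
  | succ p ih =>
    have key := hmap.comp ((Matrix.isOpenMap_mul_left_of_rank (hrank (p + 1) hp)).comp
      (ih (by lia) (Matrix.isOpenMap_map (hσ (p + 1) (by lia) (by lia)))))
    rw [show (fun A => netF d σ X (Function.update W₀ 0 A) (p + 1 + 1)) = _ from
      funext fun A => by
        rw [netF, Function.update_of_ne (Nat.succ_ne_zero p)]]
    exact key

theorem continuous_frob {m n : ℕ} : Continuous (frob (m := m) (n := n)) := by
  unfold frob
  fun_prop

theorem frob_zero {m n : ℕ} : frob (0 : Matrix (Fin m) (Fin n) ℝ) = 0 := by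
  simp [frob]

/-- For a pyramidal network (`dᵢ ≤ d_{i-1}`) with continuous strictly monotone
activations, convex loss `ℓ`, and full column rank input data `X`, every local minimum `W₀` of
`W ↦ ℓ(F_h(W))` whose weight matrices all have full row rank is a global minimum. -/
theorem statement_4 {n : ℕ} (h : ℕ) (hh : 1 ≤ h) (d : ℕ → ℕ) (σ : ℕ → ℝ → ℝ)
    (hσ : ∀ i, 1 ≤ i → i ≤ h → Continuous (σ i) ∧ (StrictMono (σ i) ∨ StrictAnti (σ i)))
    (ℓ : Matrix (Fin (d h)) (Fin n) ℝ → ℝ) (hℓ : ConvexOn ℝ Set.univ ℓ)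
    (X : Matrix (Fin (d 0)) (Fin n) ℝ) (hX : X.rank = n)
    (hpyr : ∀ i < h, d (i + 1) ≤ d i)
    (W₀ : (i : ℕ) → Matrix (Fin (d (i + 1))) (Fin (d i)) ℝ)
    (hrank : ∀ i < h, (W₀ i).rank = d (i + 1))
    (hloc : ∃ ε > 0, ∀ W : (i : ℕ) → Matrix (Fin (d (i + 1))) (Fin (d i)) ℝ,
      (∀ i < h, frob (W i - W₀ i) < ε) → ℓ (netF d σ X W₀ h) ≤ ℓ (netF d σ X W h)) :
    ∀ W : (i : ℕ) → Matrix (Fin (d (i + 1))) (Fin (d i)) ℝ,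
      ℓ (netF d σ X W₀ h) ≤ ℓ (netF d σ X W h) := by
  have hopen : ∀ i, 1 ≤ i → i ≤ h → IsOpenMap (σ i) := fun i h1 hi =>
    (hσ i h1 hi).2.elim (·.isOpenMap_of_continuous_real (hσ i h1 hi).1)
      (·.isOpenMap_of_continuous_real (hσ i h1 hi).1)
  obtain ⟨ε, hε, hmin⟩ := hloc
  obtain ⟨q, rfl⟩ : ∃ q, h = q + 1 := ⟨h - 1, by lia⟩
  have hF := isOpenMap_netF_update_first hX hopen hrank q (Nat.lt_succ_self q)
  have hnhds : {A | frob (A - W₀ 0) < ε} ∈ nhds (W₀ 0) :=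
    (isOpen_lt (continuous_frob.comp (continuous_id.sub continuous_const))
      continuous_const).mem_nhds (by simpa [frob_zero] using hε)
  have himage := hF.image_mem_nhds hnhds
  rw [Function.update_eq_self] at himage
  have hlocal : IsLocalMin ℓ (netF d σ X W₀ (q + 1)) := by
    filter_upwards [himage] with Y hY
    obtain ⟨A, hA, rfl⟩ := hY
    refine hmin _ fun i _ => ?_
    rcases eq_or_ne i 0 with rfl | hi
    · simpa using hA
    · simpa [Function.update_of_ne hi, frob_zero] using hε
  exact fun W => IsMinOn.of_isLocalMin_of_convex_univ hlocal hℓ _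
end

section
/- Let X ∈ ℝ^{d0×n}, Y ∈ ℝ^{d2×n} be arbitrary matrices and let r be a positive integer. Every local minimum of the problem: minimize (1/2)·‖Z·X − Y‖² over Z ∈ ℝ^{d2×d0} subject to rank(Z) ≤ r, is a global minimum of that problem. -/
open Matrix

open Filter Topology

/-- The squared Frobenius norm as a trace. -/
lemma frob_sq_eq_trace {m n : ℕ} (A : Matrix (Fin m) (Fin n) ℝ) :
    frob A ^ 2 = (A * Aᵀ).trace := by
  unfold frob
  have h : 0 ≤ ∑ i, ∑ j, A i j ^ 2 :=
    Finset.sum_nonneg fun i _ => Finset.sum_nonneg fun j _ => sq_nonneg _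
  rw [Real.sq_sqrt h]
  simp [Matrix.trace, Matrix.mul_apply, sq]

lemma trace_mul_transpose_self_nonneg {m n : ℕ} (A : Matrix (Fin m) (Fin n) ℝ) :
    0 ≤ (A * Aᵀ).trace := by
  rw [← frob_sq_eq_trace]; positivity

lemma eq_zero_of_trace_mul_transpose_self {m n : ℕ} {A : Matrix (Fin m) (Fin n) ℝ}
    (h : (A * Aᵀ).trace = 0) : A = 0 :=
  Matrix.trace_mul_conjTranspose_self_eq_zero_iff.1 (by simpa using h)

/-- A polynomial that is nonnegative near `0` and vanishes there has vanishing linear coefficient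
and nonnegative quadratic coefficient. -/
lemma coeff_of_eventually_nonneg {a b c d : ℝ}
    (h : ∀ᶠ t in 𝓝 (0 : ℝ), 0 ≤ a * t + b * t ^ 2 + c * t ^ 3 + d * t ^ 4) :
    a = 0 ∧ 0 ≤ b := by
  have hmin : IsLocalMin (fun t : ℝ => a * t + b * t ^ 2 + c * t ^ 3 + d * t ^ 4) 0 := by
    simpa [IsLocalMin, IsMinFilter] using h
  have hderiv : HasDerivAt (fun t : ℝ => a * t + b * t ^ 2 + c * t ^ 3 + d * t ^ 4) a 0 := by
    have h1 := (((hasDerivAt_id (0 : ℝ)).const_mul a).add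
      (((hasDerivAt_id (0 : ℝ)).pow 2).const_mul b)).add
      (((hasDerivAt_id (0 : ℝ)).pow 3).const_mul c) |>.add
      (((hasDerivAt_id (0 : ℝ)).pow 4).const_mul d)
    exact h1.congr_deriv (by simp)
  have ha : a = 0 := hmin.hasDerivAt_eq_zero hderiv
  refine ⟨ha, ?_⟩
  subst ha
  have hlim : Tendsto (fun t : ℝ => b + c * t + d * t ^ 2) (𝓝[≠] 0) (𝓝 b) := by
    have : Continuous fun t : ℝ => b + c * t + d * t ^ 2 := by fun_prop
    simpa using (this.tendsto 0).mono_left nhdsWithin_le_nhds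
  refine ge_of_tendsto hlim ?_
  filter_upwards [nhdsWithin_le_nhds h, self_mem_nhdsWithin] with t ht ht0
  have hpos : 0 < t ^ 2 := by have : t ≠ 0 := ht0; positivity
  refine nonneg_of_mul_nonneg_right (a := t ^ 2) ?_ hpos
  linarith

/-- A subspace of dimension at most `k` is contained in the range of an orthogonal projection
of rank `k`; here the subspace is given as the column space of a matrix. -/
lemma exists_orthogonal_projection {d m k : ℕ} (Z : Matrix (Fin d) (Fin m) ℝ)
    (hZ : Z.rank ≤ k) (hk : k ≤ d) :
    ∃ P : Matrix (Fin d) (Fin d) ℝ,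
      Pᵀ = P ∧ P * P = P ∧ P * Z = Z ∧ P.trace = k ∧ P.rank ≤ k := by
  let W := LinearMap.range Z.mulVecLin
  let w := Module.finBasis ℝ W
  let f : Fin d → EuclideanSpace ℝ (Fin d) := fun j =>
    if h : (j : ℕ) < Module.finrank ℝ W then WithLp.toLp 2 (w ⟨j, h⟩ : Fin d → ℝ) else 0
  obtain ⟨b, hb⟩ : ∃ b : OrthonormalBasis (Fin d) ℝ (EuclideanSpace ℝ (Fin d)),
      ∀ i j, j < i → inner ℝ (b i) (f j) = 0 :=
    ⟨InnerProductSpace.gramSchmidtOrthonormalBasis (by simp) f, fun i j hji =>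
      InnerProductSpace.gramSchmidtOrthonormalBasis_inv_triangular (by simp) f hji⟩
  let B : Matrix (Fin d) (Fin d) ℝ := Matrix.of fun i j => b j i
  have hBB : Bᵀ * B = 1 := by
    ext i j
    have := b.inner_eq_ite i j
    rw [Matrix.one_apply, ← this]
    simp [Matrix.mul_apply, B, PiLp.inner_apply, mul_comm]
  have hBB' : B * Bᵀ = 1 := mul_eq_one_comm.1 hBB
  let D : Matrix (Fin d) (Fin d) ℝ := Matrix.diagonal fun i => if (i : ℕ) < k then 1 else 0
  have hcard : Fintype.card {i : Fin d // (i : ℕ) < k} = k := by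
    rw [Fintype.card_subtype]
    have : (Finset.univ.filter fun i : Fin d => (i : ℕ) < k)
        = Finset.univ.map (Fin.castLEEmb hk) := by
      ext i
      simp only [Finset.mem_filter, Finset.mem_univ, true_and, Finset.mem_map, Fin.castLEEmb_apply]
      exact ⟨fun h => ⟨⟨i, h⟩, by ext; simp⟩, by rintro ⟨a, rfl⟩; simp⟩
    rw [this]; simp
  have hDD : D * D = D := by
    simp only [D, Matrix.diagonal_mul_diagonal]
    congr 1; ext i; split_ifs <;> simp
  have hperp : ∀ i : Fin d, k ≤ i → ∀ x ∈ W, ∑ l, b i l * x l = 0 := by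
    intro i hi x hx
    have hgen : ∀ j, ∑ l, b i l * (w j : Fin d → ℝ) l = 0 := by
      intro j
      have hj : (j : ℕ) < i := lt_of_lt_of_le j.2 (le_trans hZ hi)
      have := hb i ⟨j, hj.trans i.2⟩ hj
      simpa [f, PiLp.inner_apply, mul_comm] using this
    have hx' := congrArg Subtype.val (w.sum_repr ⟨x, hx⟩)
    simp only [AddSubmonoidClass.coe_finsetSum, SetLike.val_smul] at hx'
    rw [← hx']
    simp only [Finset.sum_apply, Pi.smul_apply, smul_eq_mul, Finset.mul_sum]
    rw [Finset.sum_comm]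
    refine Finset.sum_eq_zero fun j _ => ?_
    have := hgen j
    calc _ = w.repr ⟨x, hx⟩ j * ∑ l, b i l * (w j : Fin d → ℝ) l := by
          rw [Finset.mul_sum]; exact Finset.sum_congr rfl fun _ _ => by ring
      _ = 0 := by rw [this, mul_zero]
  have hDZ : D * (Bᵀ * Z) = Bᵀ * Z := by
    ext i j
    simp only [D, Matrix.diagonal_mul]
    split_ifs with h
    · simp
    · have := hperp i (not_lt.1 h) (Z *ᵥ Pi.single j 1) ⟨_, rfl⟩
      simp only [Matrix.mulVec_single_one, Matrix.col_apply] at this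
      simp [Matrix.mul_apply, B, this]
  refine ⟨B * D * Bᵀ, ?_, ?_, ?_, ?_, ?_⟩
  · simp [Matrix.transpose_mul, D, Matrix.mul_assoc]
  · calc B * D * Bᵀ * (B * D * Bᵀ) = B * D * (Bᵀ * B) * (D * Bᵀ) := by
          simp only [Matrix.mul_assoc]
      _ = B * (D * D) * Bᵀ := by rw [hBB]; simp only [Matrix.mul_assoc, Matrix.one_mul]
      _ = _ := by rw [hDD]
  · rw [Matrix.mul_assoc, Matrix.mul_assoc, hDZ, ← Matrix.mul_assoc, hBB', Matrix.one_mul]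
  · rw [Matrix.trace_mul_comm, ← Matrix.mul_assoc, hBB, Matrix.one_mul, Matrix.trace_diagonal]
    rw [Fintype.card_subtype] at hcard
    simp [hcard]
  · refine (Matrix.rank_mul_le_left _ _).trans ((Matrix.rank_mul_le_right _ _).trans ?_)
    rw [Matrix.rank_diagonal]
    simp [hcard]

/-- The normal equations of a least squares problem are solvable. -/
lemma exists_least_squares {d0 d2 n : ℕ} (X : Matrix (Fin d0) (Fin n) ℝ)
    (Y : Matrix (Fin d2) (Fin n) ℝ) :
    ∃ L : Matrix (Fin d2) (Fin d0) ℝ, (L * X - Y) * Xᵀ = 0 := by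
  have hle : LinearMap.range (X * Xᵀ).mulVecLin ≤ LinearMap.range X.mulVecLin := by
    rintro _ ⟨v, rfl⟩
    exact ⟨Xᵀ *ᵥ v, by simp only [Matrix.mulVecLin_apply, Matrix.mulVec_mulVec]⟩
  have heq : LinearMap.range (X * Xᵀ).mulVecLin = LinearMap.range X.mulVecLin :=
    Submodule.eq_of_le_of_finrank_eq hle (Matrix.rank_self_mul_transpose X)
  have hcol : ∀ i, ∃ v, (X * Xᵀ) *ᵥ v = X *ᵥ Y i := fun i => by
    have : X *ᵥ Y i ∈ LinearMap.range (X * Xᵀ).mulVecLin := heq ▸ ⟨Y i, rfl⟩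
    exact this
  choose L hL using hcol
  refine ⟨Matrix.of L, ?_⟩
  have h : (X * Xᵀ) * (Matrix.of L)ᵀ = X * Yᵀ := by
    ext i j
    exact congrFun (hL j) i
  have h' := congrArg Matrix.transpose h
  simp only [Matrix.transpose_mul, Matrix.transpose_transpose] at h'
  rw [Matrix.sub_mul, Matrix.mul_assoc, h', sub_self]

/-- If a quadratic form `S` is block diagonal with respect to the orthogonal projection `P`
and its values on the range of `P` dominate its values on the kernel,
then `P` maximizes `tr (P S)` among orthogonal projections of the same rank. -/
lemma trace_mul_le_of_dominates {d : ℕ} {P Q S : Matrix (Fin d) (Fin d) ℝ}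
    (hPt : Pᵀ = P) (hPP : P * P = P) (hQt : Qᵀ = Q) (hQQ : Q * Q = Q) (htr : P.trace = Q.trace)
    (hS : ∀ x, 0 ≤ x ⬝ᵥ S *ᵥ x)
    (hcross : ∀ u v, P *ᵥ u = u → P *ᵥ v = 0 → v ⬝ᵥ S *ᵥ u = 0 ∧ u ⬝ᵥ S *ᵥ v = 0)
    (hdom : ∀ u v, P *ᵥ u = u → P *ᵥ v = 0 →
      (u ⬝ᵥ u) * (v ⬝ᵥ S *ᵥ v) ≤ (v ⬝ᵥ v) * (u ⬝ᵥ S *ᵥ u)) :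
    (Q * S).trace ≤ (P * S).trace := by
  by_cases hP0 : P = 0
  · have hQ0 : Q = 0 := eq_zero_of_trace_mul_transpose_self (by
      rw [hQt, hQQ, ← htr, hP0, Matrix.trace_zero])
    rw [hP0, hQ0]
  have hPu : ∀ x, P *ᵥ (P *ᵥ x) = P *ᵥ x := fun x => by rw [Matrix.mulVec_mulVec, hPP]
  have hPv : ∀ x, P *ᵥ ((1 - P) *ᵥ x) = 0 := fun x => by
    rw [Matrix.mulVec_mulVec, Matrix.mul_sub, hPP]; simp
  have hpos : ∀ x : Fin d → ℝ, x ≠ 0 → 0 < x ⬝ᵥ x := fun x hx =>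
    lt_of_le_of_ne (Finset.sum_nonneg fun i _ => mul_self_nonneg _)
      fun h => hx (dotProduct_self_eq_zero.1 h.symm)
  obtain ⟨u₀, hu₀, hu₀'⟩ : ∃ u, P *ᵥ u = u ∧ u ≠ 0 := by
    by_contra! h
    exact hP0 (Matrix.ext_of_mulVec_single fun i => by
      rw [h _ (hPu _), Matrix.zero_mulVec])
  obtain ⟨c, hcu, hcv⟩ : ∃ c : ℝ, (∀ u, P *ᵥ u = u → c * (u ⬝ᵥ u) ≤ u ⬝ᵥ S *ᵥ u) ∧
      ∀ v, P *ᵥ v = 0 → v ⬝ᵥ S *ᵥ v ≤ c * (v ⬝ᵥ v) := by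
    by_cases hv : ∃ v, P *ᵥ v = 0 ∧ v ≠ 0
    · obtain ⟨v₀, hv₀, hv₀'⟩ := hv
      obtain ⟨c, hc1, hc2⟩ := exists_between_of_forall_le
        (s := {a | ∃ v, (P *ᵥ v = 0 ∧ v ≠ 0) ∧ a = (v ⬝ᵥ S *ᵥ v) / (v ⬝ᵥ v)})
        (t := {a | ∃ u, (P *ᵥ u = u ∧ u ≠ 0) ∧ a = (u ⬝ᵥ S *ᵥ u) / (u ⬝ᵥ u)})
        ⟨_, v₀, ⟨hv₀, hv₀'⟩, rfl⟩ ⟨_, u₀, ⟨hu₀, hu₀'⟩, rfl⟩ (by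
          rintro _ ⟨v, ⟨hv, hv'⟩, rfl⟩ _ ⟨u, ⟨hu, hu'⟩, rfl⟩
          rw [div_le_div_iff₀ (hpos v hv') (hpos u hu')]
          have := hdom u v hu hv
          linarith)
      refine ⟨c, fun u hu => ?_, fun v hv => ?_⟩
      · by_cases h0 : u = 0
        · simp [h0]
        · exact (le_div_iff₀ (hpos u h0)).1 (hc2 ⟨u, ⟨hu, h0⟩, rfl⟩)
      · by_cases h0 : v = 0
        · simp [h0]
        · exact (div_le_iff₀ (hpos v h0)).1 (hc1 ⟨v, ⟨hv, h0⟩, rfl⟩)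
    · push Not at hv
      exact ⟨0, fun u _ => by simpa using hS u, fun v hv' => by simp [hv v hv']⟩
  let D := S - c • (1 : Matrix (Fin d) (Fin d) ℝ)
  have hDq : ∀ x y, x ⬝ᵥ D *ᵥ y = x ⬝ᵥ S *ᵥ y - c * (x ⬝ᵥ y) := fun x y => by
    simp [D, Matrix.sub_mulVec, Matrix.smul_mulVec, dotProduct_sub]
  have htq : ∀ A C : Matrix (Fin d) (Fin d) ℝ,
      (Aᵀ * C * A).trace = ∑ i, A.col i ⬝ᵥ C *ᵥ A.col i := fun A C => by
    rw [Matrix.mul_assoc]; rfl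
  have hQ't : (1 - Q)ᵀ = 1 - Q := by simp [hQt]
  have hP't : (1 - P)ᵀ = 1 - P := by simp [hPt]
  have horth : ∀ x y, (P *ᵥ x) ⬝ᵥ ((1 - P) *ᵥ y) = 0 := fun x y => by
    rw [← Matrix.vecMul_transpose, hPt, ← Matrix.dotProduct_mulVec, hPv, dotProduct_zero]
  have hD1 : P * D * (1 - P) = 0 := by
    refine Matrix.ext_of_mulVec_single fun i => ?_
    rw [Matrix.zero_mulVec]
    refine dotProduct_eq_zero _ fun x => ?_
    rw [dotProduct_comm, ← Matrix.mulVec_mulVec, ← Matrix.mulVec_mulVec, Matrix.dotProduct_mulVec,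
      ← Matrix.mulVec_transpose, hPt, hDq, (hcross _ _ (hPu _) (hPv _)).2, horth]
    simp
  have hD2 : (1 - P) * D * P = 0 := by
    refine Matrix.ext_of_mulVec_single fun i => ?_
    rw [Matrix.zero_mulVec]
    refine dotProduct_eq_zero _ fun x => ?_
    rw [dotProduct_comm, ← Matrix.mulVec_mulVec, ← Matrix.mulVec_mulVec, Matrix.dotProduct_mulVec,
      ← Matrix.mulVec_transpose, hP't, hDq, (hcross _ _ (hPu _) (hPv _)).1,
      dotProduct_comm, horth]
    simp
  have h1 : 0 ≤ ((P * (1 - Q))ᵀ * D * (P * (1 - Q))).trace := by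
    rw [htq]
    refine Finset.sum_nonneg fun i _ => ?_
    have : (P * (1 - Q)).col i = P *ᵥ (1 - Q).col i := rfl
    rw [this, hDq]
    linarith [hcu _ (hPu ((1 - Q).col i))]
  have h2 : (((1 - P) * Q)ᵀ * D * ((1 - P) * Q)).trace ≤ 0 := by
    rw [htq]
    refine Finset.sum_nonpos fun i _ => ?_
    have : ((1 - P) * Q).col i = (1 - P) *ᵥ Q.col i := rfl
    rw [this, hDq]
    linarith [hcv _ (hPv (Q.col i))]
  have hQ'Q' : (1 - Q) * (1 - Q) = 1 - Q := by noncomm_ring [hQQ]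
  have e1 : ((P * (1 - Q))ᵀ * D * (P * (1 - Q))).trace = ((1 - Q) * (P * D * P)).trace := by
    rw [Matrix.transpose_mul, hPt, hQ't]
    calc _ = (((1 - Q) * (P * D * P)) * (1 - Q)).trace := by simp only [Matrix.mul_assoc]
      _ = _ := by rw [Matrix.trace_mul_comm, ← Matrix.mul_assoc, hQ'Q']
  have e2 : (((1 - P) * Q)ᵀ * D * ((1 - P) * Q)).trace
      = (Q * ((1 - P) * D * (1 - P))).trace := by
    rw [Matrix.transpose_mul, hP't, hQt]
    calc _ = ((Q * ((1 - P) * D * (1 - P))) * Q).trace := by simp only [Matrix.mul_assoc]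
      _ = _ := by rw [Matrix.trace_mul_comm, ← Matrix.mul_assoc, hQQ]
  have hsplit : D = P * D * P + (1 - P) * D * (1 - P) := by
    have : D = P * D * P + (1 - P) * D * (1 - P) + P * D * (1 - P) + (1 - P) * D * P := by
      noncomm_ring
    rw [hD1, hD2, add_zero, add_zero] at this
    exact this
  have e3 : (P * D).trace = (P * D * P).trace := by
    rw [Matrix.trace_mul_comm (P * D) P, ← Matrix.mul_assoc, hPP]
  have e4 : (Q * D).trace
      = (Q * (P * D * P)).trace + (Q * ((1 - P) * D * (1 - P))).trace := by
    rw [← Matrix.trace_add, ← Matrix.mul_add, ← hsplit]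
  have e5 : ((1 - Q) * (P * D * P)).trace = (P * D * P).trace - (Q * (P * D * P)).trace := by
    rw [Matrix.sub_mul, Matrix.one_mul, Matrix.trace_sub]
  have e6 : ∀ A : Matrix (Fin d) (Fin d) ℝ, (A * D).trace = (A * S).trace - c * A.trace := by
    intro A
    simp [D, Matrix.mul_sub]
  have := e6 P
  have := e6 Q
  rw [htr] at *
  linarith

/-- Near a local minimum, the objective does not decrease along feasible curves. -/
lemma eventually_le_of_local_min {d0 d2 n r : ℕ} {X : Matrix (Fin d0) (Fin n) ℝ}
    {Y : Matrix (Fin d2) (Fin n) ℝ} {Z₀ : Matrix (Fin d2) (Fin d0) ℝ}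
    (hloc : ∃ ε > 0, ∀ Z : Matrix (Fin d2) (Fin d0) ℝ, Z.rank ≤ r → frob (Z - Z₀) < ε →
      (1 / 2) * frob (Z₀ * X - Y) ^ 2 ≤ (1 / 2) * frob (Z * X - Y) ^ 2)
    {γ : ℝ → Matrix (Fin d2) (Fin d0) ℝ} (hγ : Continuous γ) (h0 : γ 0 = Z₀)
    (hrank : ∀ t, (γ t).rank ≤ r) :
    ∀ᶠ t in 𝓝 (0 : ℝ), frob (Z₀ * X - Y) ^ 2 ≤ frob (γ t * X - Y) ^ 2 := by
  obtain ⟨ε, hε, hmin⟩ := hloc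
  have hcont : Continuous fun t => frob (γ t - Z₀) := by
    unfold frob
    simp only [Matrix.sub_apply]
    have : ∀ i j, Continuous fun t => γ t i j := fun i j => hγ.matrix_elem i j
    fun_prop
  have hz : frob (γ 0 - Z₀) < ε := by simpa [h0, frob] using hε
  filter_upwards [hcont.continuousAt.eventually_lt continuousAt_const hz] with t ht
  linarith [hmin (γ t) (hrank t) ht]

/-- Pythagorean decomposition of the objective around a solution `T` of the normal equations. -/
lemma frob_sq_residual {d0 d2 n : ℕ} {X : Matrix (Fin d0) (Fin n) ℝ}
    {Y : Matrix (Fin d2) (Fin n) ℝ} {T : Matrix (Fin d2) (Fin d0) ℝ}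
    (hT : (T * X - Y) * Xᵀ = 0) (Z : Matrix (Fin d2) (Fin d0) ℝ) :
    frob (Z * X - Y) ^ 2
      = (((Z - T) * X) * ((Z - T) * X)ᵀ).trace + frob (T * X - Y) ^ 2 := by
  have hT' : X * (T * X - Y)ᵀ = 0 := by
    simpa [Matrix.transpose_mul] using congrArg Matrix.transpose hT
  have h : Z * X - Y = (Z - T) * X + (T * X - Y) := by rw [Matrix.sub_mul]; abel
  rw [frob_sq_eq_trace, frob_sq_eq_trace, h, Matrix.transpose_add, Matrix.add_mul, Matrix.mul_add,
    Matrix.mul_add, Matrix.mul_assoc (Z - T) X (T * X - Y)ᵀ, hT', Matrix.transpose_mul,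
    ← Matrix.mul_assoc (T * X - Y) Xᵀ, hT]
  simp [Matrix.trace_add]

/-- First-order optimality of a local minimum, within matrices whose range lies in that of `P`. -/
lemma proj_mul_residual_eq_zero {d0 d2 n r : ℕ} {X : Matrix (Fin d0) (Fin n) ℝ}
    {Y : Matrix (Fin d2) (Fin n) ℝ} {Z₀ : Matrix (Fin d2) (Fin d0) ℝ}
    (hloc : ∃ ε > 0, ∀ Z : Matrix (Fin d2) (Fin d0) ℝ, Z.rank ≤ r → frob (Z - Z₀) < ε →
      (1 / 2) * frob (Z₀ * X - Y) ^ 2 ≤ (1 / 2) * frob (Z * X - Y) ^ 2)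
    {P : Matrix (Fin d2) (Fin d2) ℝ} (hPt : Pᵀ = P) (hPZ : P * Z₀ = Z₀) (hPr : P.rank ≤ r) :
    P * ((Z₀ * X - Y) * Xᵀ) = 0 := by
  let R := Z₀ * X - Y
  let G := R * Xᵀ
  have hev := eventually_le_of_local_min hloc (γ := fun t => P * (Z₀ + t • (P * G)))
    (by fun_prop) (by simp [hPZ]) fun t => (Matrix.rank_mul_le_left _ _).trans hPr
  let A := P * (P * G) * X
  have hexp : ∀ t : ℝ, frob (P * (Z₀ + t • (P * G)) * X - Y) ^ 2
      = frob R ^ 2 + (2 * (A * Rᵀ).trace * t + (A * Aᵀ).trace * t ^ 2) := by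
    intro t
    have h : P * (Z₀ + t • (P * G)) * X - Y = R + t • A := by
      simp only [Matrix.mul_add, hPZ, Matrix.add_mul, Matrix.mul_smul, Matrix.smul_mul, R, A]
      abel
    have hs : (R * Aᵀ).trace = (A * Rᵀ).trace := by
      rw [← Matrix.trace_transpose]; simp [Matrix.transpose_mul]
    rw [h, frob_sq_eq_trace, frob_sq_eq_trace]
    simp only [Matrix.transpose_add, Matrix.transpose_smul, Matrix.add_mul, Matrix.mul_add,
      Matrix.smul_mul, Matrix.mul_smul, Matrix.trace_add, Matrix.trace_smul, smul_eq_mul, hs]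
    ring
  have hz := (coeff_of_eventually_nonneg (a := 2 * (A * Rᵀ).trace) (b := (A * Aᵀ).trace)
    (c := 0) (d := 0) (by
      filter_upwards [hev] with t ht
      rw [hexp] at ht
      linarith)).1
  refine eq_zero_of_trace_mul_transpose_self (A := P * G) ?_
  have : (A * Rᵀ).trace = ((P * G) * (P * G)ᵀ).trace := by
    calc (A * Rᵀ).trace = (P * ((P * G) * (X * Rᵀ))).trace := by simp only [A, Matrix.mul_assoc]
      _ = _ := by
        rw [Matrix.trace_mul_comm]
        simp [Matrix.transpose_mul, hPt, G, Matrix.mul_assoc]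
  linarith

/-- Second-order optimality: for `Z₀ = P T`, with `T` solving the normal equations, the form
`S = T X (T X)ᵀ` is block diagonal with respect to `P` and is larger on the range of `P` than on
its kernel. -/
lemma cross_and_dominates_of_local_min {d0 d2 n r : ℕ} {X : Matrix (Fin d0) (Fin n) ℝ}
    {Y : Matrix (Fin d2) (Fin n) ℝ} {Z₀ T : Matrix (Fin d2) (Fin d0) ℝ}
    (hloc : ∃ ε > 0, ∀ Z : Matrix (Fin d2) (Fin d0) ℝ, Z.rank ≤ r → frob (Z - Z₀) < ε →
      (1 / 2) * frob (Z₀ * X - Y) ^ 2 ≤ (1 / 2) * frob (Z * X - Y) ^ 2)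
    {P S : Matrix (Fin d2) (Fin d2) ℝ} (hPt : Pᵀ = P) (hPr : P.rank ≤ r)
    (hPT : P * T = Z₀) (hT : (T * X - Y) * Xᵀ = 0) (hS : S = (T * X) * (T * X)ᵀ)
    {u v : Fin d2 → ℝ} (hu : P *ᵥ u = u) (hv : P *ᵥ v = 0) :
    u ⬝ᵥ S *ᵥ v = 0 ∧ (u ⬝ᵥ u) * (v ⬝ᵥ S *ᵥ v) ≤ (v ⬝ᵥ v) * (u ⬝ᵥ S *ᵥ u) := by
  let N := vecMulVec v u
  let E : ℝ → Matrix (Fin d2) (Fin d2) ℝ := fun t => (1 + t • N) * P * (1 + t • Nᵀ)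
  have hSt : Sᵀ = S := by rw [hS]; simp [Matrix.transpose_mul]
  have huP : u ᵥ* P = u := by rw [← Matrix.mulVec_transpose, hPt, hu]
  have hvP : v ᵥ* P = 0 := by rw [← Matrix.mulVec_transpose, hPt, hv]
  have hNP : N * P = N := by simp only [N, Matrix.vecMulVec_mul, huP]
  have hPN : P * Nᵀ = Nᵀ := by
    simp only [N, Matrix.transpose_vecMulVec, Matrix.mul_vecMulVec, hu]
  let M0 := P - 1
  let M1 := N + Nᵀ
  let M2 := N * Nᵀ
  have hM0 : M0ᵀ = M0 := by simp [M0, hPt]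
  have hM1 : M1ᵀ = M1 := by simp [M1, add_comm]
  have hM2 : M2ᵀ = M2 := by simp [M2, Matrix.transpose_mul]
  have hE : ∀ t, E t - 1 = M0 + t • M1 + t ^ 2 • M2 := by
    intro t
    simp only [E, M0, M1, M2, Matrix.add_mul, Matrix.mul_add, Matrix.one_mul, Matrix.mul_one,
      Matrix.smul_mul, Matrix.mul_smul, hNP, hPN, smul_add, smul_smul, sq]
    abel
  have hev := eventually_le_of_local_min hloc (γ := fun t => E t * T)
    (by fun_prop) (by simp [E, hPT]) fun t => by
      refine (Matrix.rank_mul_le_left _ _).trans ((Matrix.rank_mul_le_left _ _).trans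
        ((Matrix.rank_mul_le_right _ _).trans hPr))
  have hobj : ∀ C : Matrix (Fin d2) (Fin d2) ℝ, frob (C * T * X - Y) ^ 2
      = ((C - 1) * S * (C - 1)ᵀ).trace + frob (T * X - Y) ^ 2 := by
    intro C
    have h : (C * T - T) * X = (C - 1) * (T * X) := by
      simp [Matrix.sub_mul, Matrix.mul_assoc]
    rw [frob_sq_residual hT, h, hS, Matrix.transpose_mul (C - 1)]
    simp only [Matrix.mul_assoc]
  have hsym : ∀ A C : Matrix (Fin d2) (Fin d2) ℝ, Aᵀ = A → Cᵀ = C →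
      (A * S * C).trace = (C * S * A).trace := by
    intro A C hA hC
    rw [← Matrix.trace_transpose]
    simp [Matrix.transpose_mul, hA, hC, hSt, Matrix.mul_assoc]
  have hcoef := coeff_of_eventually_nonneg (a := 2 * (M0 * S * M1).trace)
    (b := (M1 * S * M1).trace + 2 * (M0 * S * M2).trace)
    (c := 2 * (M1 * S * M2).trace) (d := (M2 * S * M2).trace) (by
      filter_upwards [hev] with t ht
      rw [hobj, hE, ← hPT, hobj] at ht
      change (M0 * S * M0ᵀ).trace + _ ≤ _ at ht
      simp only [Matrix.transpose_add, Matrix.transpose_smul, hM0, hM1, hM2, Matrix.add_mul,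
        Matrix.mul_add, Matrix.smul_mul, Matrix.mul_smul, Matrix.trace_add, Matrix.trace_smul,
        smul_eq_mul, hsym M1 M0 hM1 hM0, hsym M2 M0 hM2 hM0, hsym M2 M1 hM2 hM1] at ht
      linarith)
  have htq : ∀ x y : Fin d2 → ℝ, (S * vecMulVec x y).trace = y ⬝ᵥ S *ᵥ x := by
    intro x y
    rw [Matrix.mul_vecMulVec, Matrix.trace_vecMulVec, dotProduct_comm]
  have hqs : v ⬝ᵥ S *ᵥ u = u ⬝ᵥ S *ᵥ v := by
    rw [Matrix.dotProduct_mulVec, ← Matrix.mulVec_transpose, hSt, dotProduct_comm]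
  have hcyc : ∀ A C : Matrix (Fin d2) (Fin d2) ℝ, (A * S * C).trace = (S * (C * A)).trace := by
    intro A C
    rw [Matrix.mul_assoc, Matrix.trace_mul_comm, Matrix.mul_assoc]
  have hNN : vecMulVec v u * vecMulVec u v = (u ⬝ᵥ u) • vecMulVec v v := by
    rw [Matrix.vecMulVec_mul_vecMulVec, Matrix.vecMulVec_smul]
  have e1 : M1 * M0 = -vecMulVec u v := by
    simp [M1, M0, N, Matrix.mul_sub, Matrix.add_mul, Matrix.vecMulVec_mul, huP, hvP,
      Matrix.transpose_vecMulVec]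
  have e2 : M2 * M0 = -((u ⬝ᵥ u) • vecMulVec v v) := by
    simp only [M2, M0, N, Matrix.transpose_vecMulVec, hNN]
    simp [Matrix.mul_sub, Matrix.vecMulVec_mul, hvP]
  have e3 : (S * (M1 * M1)).trace
      = (u ⬝ᵥ u) * (v ⬝ᵥ S *ᵥ v) + (v ⬝ᵥ v) * (u ⬝ᵥ S *ᵥ u) := by
    have huv : u ⬝ᵥ v = 0 := by
      rw [← huP, ← Matrix.dotProduct_mulVec, hv, dotProduct_zero]
    have huv' : v ⬝ᵥ u = 0 := by rw [dotProduct_comm, huv]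
    simp only [M1, N, Matrix.transpose_vecMulVec, Matrix.add_mul, Matrix.mul_add,
      Matrix.vecMulVec_mul_vecMulVec, huv, huv', Matrix.vecMulVec_smul, zero_smul,
      Matrix.mul_smul, Matrix.trace_add, Matrix.trace_smul, htq, smul_eq_mul,
      zero_dotProduct]
    ring
  rw [hcyc, hcyc, hcyc, e1, e2, e3] at hcoef
  simp only [Matrix.mul_neg, Matrix.mul_smul, Matrix.trace_neg, Matrix.trace_smul, htq,
    smul_eq_mul] at hcoef
  exact ⟨by linarith [hcoef.1], by linarith [hcoef.2]⟩

/-- For arbitrary `X`, `Y` and any positive integer `r`, every local minimum of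
`(1/2)·‖Z·X − Y‖²` over matrices `Z` with `rank Z ≤ r` is a global minimum of that problem. -/
theorem statement_5 {d0 d2 n : ℕ} (X : Matrix (Fin d0) (Fin n) ℝ)
    (Y : Matrix (Fin d2) (Fin n) ℝ) (r : ℕ) (hr : 0 < r)
    (Z₀ : Matrix (Fin d2) (Fin d0) ℝ) (hZ₀ : Z₀.rank ≤ r)
    (hloc : ∃ ε > 0, ∀ Z : Matrix (Fin d2) (Fin d0) ℝ, Z.rank ≤ r → frob (Z - Z₀) < ε →
      (1 / 2) * frob (Z₀ * X - Y) ^ 2 ≤ (1 / 2) * frob (Z * X - Y) ^ 2) :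
    ∀ Z : Matrix (Fin d2) (Fin d0) ℝ, Z.rank ≤ r →
      (1 / 2) * frob (Z₀ * X - Y) ^ 2 ≤ (1 / 2) * frob (Z * X - Y) ^ 2 := by
  let k := min r d2
  have hrank : ∀ Z : Matrix (Fin d2) (Fin d0) ℝ, Z.rank ≤ r → Z.rank ≤ k := fun Z hZ =>
    le_min hZ (Z.rank_le_height)
  obtain ⟨P, hPt, hPP, hPZ, hPtr, hPr⟩ :=
    exists_orthogonal_projection Z₀ (hrank _ hZ₀) (min_le_right r d2)
  have hPr' : P.rank ≤ r := hPr.trans (min_le_left _ _)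
  obtain ⟨L, hL⟩ := exists_least_squares X Y
  have hfirst := proj_mul_residual_eq_zero hloc hPt hPZ hPr'
  let T := Z₀ + (1 - P) * L
  have hPT : P * T = Z₀ := by
    have : P * (1 - P) = 0 := by rw [Matrix.mul_sub, hPP]; simp
    simp only [T]
    rw [Matrix.mul_add, ← Matrix.mul_assoc, this, hPZ, Matrix.zero_mul, add_zero]
  have hT : (T * X - Y) * Xᵀ = 0 := by
    have h : T * X - Y = P * (Z₀ * X - Y) + (1 - P) * (L * X - Y) := by
      simp only [T, Matrix.add_mul, Matrix.mul_sub, Matrix.sub_mul, Matrix.one_mul,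
        ← Matrix.mul_assoc, hPZ]
      abel
    rw [h, Matrix.add_mul, Matrix.mul_assoc, hfirst, Matrix.mul_assoc, hL, Matrix.mul_zero,
      add_zero]
  let S := (T * X) * (T * X)ᵀ
  have hSt : Sᵀ = S := by simp [S, Matrix.transpose_mul]
  have hopt := fun (u v : Fin d2 → ℝ) (hu : P *ᵥ u = u) (hv : P *ᵥ v = 0) =>
    cross_and_dominates_of_local_min hloc hPt hPr' hPT hT (S := S) rfl hu hv
  have hS : ∀ x, 0 ≤ x ⬝ᵥ S *ᵥ x := by
    intro x
    have : x ⬝ᵥ S *ᵥ x = (x ᵥ* (T * X)) ⬝ᵥ (x ᵥ* (T * X)) := by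
      simp only [S]
      rw [← Matrix.mulVec_mulVec, Matrix.dotProduct_mulVec, Matrix.mulVec_transpose]
    rw [this]
    exact Finset.sum_nonneg fun i _ => mul_self_nonneg _
  intro Z hZ
  obtain ⟨Q, hQt, hQQ, hQZ, hQtr, -⟩ :=
    exists_orthogonal_projection Z (hrank _ hZ) (min_le_right r d2)
  have hmax : (Q * S).trace ≤ (P * S).trace :=
    trace_mul_le_of_dominates hPt hPP hQt hQQ (hPtr.trans hQtr.symm) hS
      (fun u v hu hv => ⟨by
        rw [Matrix.dotProduct_mulVec, ← Matrix.mulVec_transpose, hSt, dotProduct_comm]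
        exact (hopt u v hu hv).1, (hopt u v hu hv).1⟩)
      fun u v hu hv => (hopt u v hu hv).2
  have hproj : ∀ (R : Matrix (Fin d2) (Fin d2) ℝ) (B : Matrix (Fin d2) (Fin n) ℝ), Rᵀ = R →
      R * R = R → (((1 - R) * B) * ((1 - R) * B)ᵀ).trace
        = (B * Bᵀ).trace - (R * (B * Bᵀ)).trace := by
    intro R B hRt hRR
    have h1 : (1 - R)ᵀ = 1 - R := by simp [hRt]
    have h2 : (1 - R) * (1 - R) = 1 - R := by noncomm_ring [hRR]
    rw [Matrix.transpose_mul, h1, ← Matrix.mul_assoc, Matrix.trace_mul_comm, ← Matrix.mul_assoc,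
      ← Matrix.mul_assoc, h2, Matrix.mul_assoc, Matrix.sub_mul, Matrix.one_mul, Matrix.trace_sub]
  have hfZ₀ : frob (Z₀ * X - Y) ^ 2
      = S.trace - (P * S).trace + frob (T * X - Y) ^ 2 := by
    have h : (Z₀ - T) * X = -((1 - P) * (T * X)) := by
      rw [← hPT]; simp [Matrix.sub_mul, Matrix.mul_assoc]
    rw [frob_sq_residual hT, h, Matrix.transpose_neg, Matrix.neg_mul, Matrix.mul_neg, neg_neg, hproj P _ hPt hPP]
  have hfZ : S.trace - (Q * S).trace + frob (T * X - Y) ^ 2 ≤ frob (Z * X - Y) ^ 2 := by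
    let B := (Z - T) * X
    have h : (1 - Q) * B = -((1 - Q) * (T * X)) := by
      have : (1 - Q) * Z = 0 := by rw [Matrix.sub_mul, hQZ, Matrix.one_mul, sub_self]
      simp only [B]
      rw [← Matrix.mul_assoc, Matrix.mul_sub, this, zero_sub, Matrix.neg_mul, Matrix.mul_assoc]
    have h1 := hproj Q B hQt hQQ
    rw [h, Matrix.transpose_neg, Matrix.neg_mul, Matrix.mul_neg, neg_neg, hproj Q _ hQt hQQ] at h1
    have h2 : 0 ≤ (Q * (B * Bᵀ)).trace := by
      have h3 := trace_mul_transpose_self_nonneg (Q * B)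
      rwa [Matrix.transpose_mul, hQt, ← Matrix.mul_assoc, Matrix.trace_mul_comm,
        ← Matrix.mul_assoc, ← Matrix.mul_assoc, hQQ, Matrix.mul_assoc] at h3
    rw [frob_sq_residual hT Z]
    change _ ≤ (B * Bᵀ).trace + _
    linarith
  linarith
end

section
/- Consider the two-layer linear network objective f(W2, W1) = (1/2)·‖W2·W1·X − Y‖² with W2 ∈ ℝ^{d2×d1}, W1 ∈ ℝ^{d1×d0}, X ∈ ℝ^{d0×n}, Y ∈ ℝ^{d2×n} arbitrary. Every degenerate critical point (W̄2, W̄1) of f, i.e., a point where the gradient of f vanishes and rank(W̄2·W̄1) < min(d2, d1, d0), is either a global minimum of f or a second order saddle point: there exists a direction (A, B) ∈ ℝ^{d2×d1} × ℝ^{d1×d0} such that the function g(t) = f(W̄2 + t·A, W̄1 + t·B) satisfies g′(0) = 0 and g″(0) < 0. -/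
open Matrix

lemma frob_sq {m n : ℕ} (A : Matrix (Fin m) (Fin n) ℝ) :
    frob A ^ 2 = ∑ i, ∑ j, (A i j) ^ 2 :=
  Real.sq_sqrt (by positivity)

/-- Moving a right factor to the other side of the Frobenius inner product. -/
lemma sum_mul_mul_eq {m k n : ℕ} (E : Matrix (Fin m) (Fin n) ℝ) (M : Matrix (Fin m) (Fin k) ℝ)
    (X : Matrix (Fin k) (Fin n) ℝ) :
    ∑ i, ∑ j, E i j * (M * X) i j = ∑ i, ∑ l, (E * Xᵀ) i l * M i l := by
  refine Finset.sum_congr rfl fun i _ => ?_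
  simp only [mul_apply, transpose_apply, Finset.mul_sum, Finset.sum_mul]
  rw [Finset.sum_comm]
  exact Finset.sum_congr rfl fun l _ => Finset.sum_congr rfl fun j _ => by ring

/-- If the residual is orthogonal to the row space of `X`, then `W` is a least squares solution. -/
lemma frob_sq_le_of_mul_transpose_eq_zero {m k n : ℕ} (X : Matrix (Fin k) (Fin n) ℝ)
    (Y : Matrix (Fin m) (Fin n) ℝ) (W V : Matrix (Fin m) (Fin k) ℝ)
    (h : (W * X - Y) * Xᵀ = 0) :
    frob (W * X - Y) ^ 2 ≤ frob (V * X - Y) ^ 2 := by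
  have horth : ∑ i, ∑ j, (W * X - Y) i j * ((V - W) * X) i j = 0 := by
    rw [sum_mul_mul_eq, h]
    simp
  have hexp : frob (V * X - Y) ^ 2 = frob (W * X - Y) ^ 2
      + 2 * ∑ i, ∑ j, (W * X - Y) i j * ((V - W) * X) i j + frob ((V - W) * X) ^ 2 := by
    simp only [frob_sq, Finset.mul_sum, ← Finset.sum_add_distrib]
    refine Finset.sum_congr rfl fun i _ => Finset.sum_congr rfl fun j _ => ?_
    simp only [Matrix.sub_mul, Matrix.sub_apply]
    ring
  rw [hexp, horth]
  linarith [sq_nonneg (frob ((V - W) * X))]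

lemma deriv_deriv_quartic (c₀ c₁ c₂ c₃ c₄ : ℝ) :
    deriv (deriv fun t : ℝ => c₀ + c₁ * t + c₂ * t ^ 2 + c₃ * t ^ 3 + c₄ * t ^ 4) 0 = 2 * c₂ := by
  have h₁ : (deriv fun t : ℝ => c₀ + c₁ * t + c₂ * t ^ 2 + c₃ * t ^ 3 + c₄ * t ^ 4)
      = fun t => c₁ + 2 * c₂ * t + 3 * c₃ * t ^ 2 + 4 * c₄ * t ^ 3 := by
    funext t
    refine HasDerivAt.deriv (HasDerivAt.congr_deriv (((((hasDerivAt_const t c₀).add ((hasDerivAt_id t).const_mul c₁)).add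
      ((hasDerivAt_pow 2 t).const_mul c₂)).add ((hasDerivAt_pow 3 t).const_mul c₃)).add
      ((hasDerivAt_pow 4 t).const_mul c₄)) ?_)
    norm_num
    ring
  rw [h₁]
  refine HasDerivAt.deriv (HasDerivAt.congr_deriv ((((hasDerivAt_const 0 c₁).add ((hasDerivAt_id (0 : ℝ)).const_mul (2 * c₂))).add
    ((hasDerivAt_pow 2 (0 : ℝ)).const_mul (3 * c₃))).add
    ((hasDerivAt_pow 3 (0 : ℝ)).const_mul (4 * c₄))) ?_)
  norm_num

/-- The second derivative of the objective along the line in direction `(A, B)`. -/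
lemma deriv_deriv_objective {d0 d1 d2 n : ℕ} (X : Matrix (Fin d0) (Fin n) ℝ)
    (Y : Matrix (Fin d2) (Fin n) ℝ) (W₂ A : Matrix (Fin d2) (Fin d1) ℝ)
    (W₁ B : Matrix (Fin d1) (Fin d0) ℝ) :
    deriv (deriv (fun t : ℝ =>
        (1 / 2) * frob ((W₂ + t • A) * (W₁ + t • B) * X - Y) ^ 2)) 0
      = frob ((A * W₁ + W₂ * B) * X) ^ 2
        + 2 * ∑ i, ∑ k, ((W₂ * W₁ * X - Y) * Xᵀ) i k * (A * B) i k := by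
  rw [← sum_mul_mul_eq, frob_sq]
  set E := W₂ * W₁ * X - Y with hE
  set P := (A * W₁ + W₂ * B) * X with hP
  set Q := A * B * X with hQ
  have hline (t : ℝ) : (W₂ + t • A) * (W₁ + t • B) * X - Y = E + t • P + t ^ 2 • Q := by
    simp only [hE, hP, hQ, Matrix.add_mul, Matrix.mul_add, Matrix.smul_mul, Matrix.mul_smul,
      smul_add, smul_smul, pow_two]
    abel
  have hpoly : (fun t : ℝ => (1 / 2) * frob ((W₂ + t • A) * (W₁ + t • B) * X - Y) ^ 2)
      = fun t => (∑ i, ∑ j, (1 / 2) * E i j ^ 2) + (∑ i, ∑ j, E i j * P i j) * t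
        + (∑ i, ∑ j, ((1 / 2) * P i j ^ 2 + E i j * Q i j)) * t ^ 2
        + (∑ i, ∑ j, P i j * Q i j) * t ^ 3 + (∑ i, ∑ j, (1 / 2) * Q i j ^ 2) * t ^ 4 := by
    funext t
    rw [hline, frob_sq]
    simp only [Finset.mul_sum, Finset.sum_mul, ← Finset.sum_add_distrib]
    refine Finset.sum_congr rfl fun i _ => Finset.sum_congr rfl fun j _ => ?_
    simp only [Matrix.add_apply, Matrix.smul_apply, smul_eq_mul]
    ring
  rw [hpoly, deriv_deriv_quartic]
  simp only [Finset.mul_sum, ← Finset.sum_add_distrib]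
  exact Finset.sum_congr rfl fun i _ => Finset.sum_congr rfl fun j _ => by ring

/-- A product of a matrix with trivial kernel and a matrix with trivial left kernel has full inner
rank. -/
lemma rank_mul_eq_of_ker_eq_bot {d0 d1 d2 : ℕ} (W₂ : Matrix (Fin d2) (Fin d1) ℝ)
    (W₁ : Matrix (Fin d1) (Fin d0) ℝ) (h₂ : ∀ u, W₂ *ᵥ u = 0 → u = 0)
    (h₁ : ∀ v, v ᵥ* W₁ = 0 → v = 0) : (W₂ * W₁).rank = d1 := by
  have hinj : Function.Injective W₂.mulVecLin :=
    (injective_iff_map_eq_zero _).2 fun u hu => h₂ u (by simpa using hu)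
  have hrank : W₁.rank = d1 := by
    have hli : LinearIndependent ℝ W₁.row :=
      vecMul_injective_iff.1 ((injective_iff_map_eq_zero W₁.vecMulLinear).2
        fun v hv => h₁ v (by simpa using hv))
    simpa using hli.rank_matrix
  rw [rank, mulVecLin_mul, LinearMap.range_comp,
    ← (Submodule.equivMapOfInjective _ hinj _).finrank_eq]
  exact hrank

lemma vecMulVec_mul_vecMulVec_normalized {l m n : ℕ} (a : Fin l → ℝ) {u : Fin m → ℝ} (hu : u ≠ 0)
    (b : Fin n → ℝ) :
    vecMulVec a u * vecMulVec ((u ⬝ᵥ u)⁻¹ • u) b = vecMulVec a b := by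
  have h : u ⬝ᵥ u ≠ 0 := dotProduct_self_eq_zero.not.2 hu
  rw [vecMulVec_mul_vecMulVec, dotProduct_smul, smul_eq_mul, inv_mul_cancel₀ h, one_smul]

lemma exists_add_mul_neg (p : ℝ) {g : ℝ} (hg : g ≠ 0) : ∃ s : ℝ, p + 2 * (s * g) < 0 :=
  ⟨-(p + 1) / (2 * g), by field_simp; linarith⟩

/-- Every degenerate critical point of the two-layer objective
`f(W2, W1) = (1/2)·‖W2·W1·X − Y‖²` (vanishing gradient, i.e. vanishing derivative in every
direction, and `rank(W2·W1) < min(d2, d1, d0)`) is either a global minimum or a second order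
saddle point: along some direction `(A, B)` the function `g(t) = f(W2 + tA, W1 + tB)` satisfies
`g′(0) = 0` and `g″(0) < 0`. -/
theorem statement_7 {d0 d1 d2 n : ℕ} (X : Matrix (Fin d0) (Fin n) ℝ)
    (Y : Matrix (Fin d2) (Fin n) ℝ)
    (W₂ : Matrix (Fin d2) (Fin d1) ℝ) (W₁ : Matrix (Fin d1) (Fin d0) ℝ)
    (hcrit : ∀ (A : Matrix (Fin d2) (Fin d1) ℝ) (B : Matrix (Fin d1) (Fin d0) ℝ),
      HasDerivAt (fun t : ℝ =>
        (1 / 2) * frob ((W₂ + t • A) * (W₁ + t • B) * X - Y) ^ 2) 0 0)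
    (hdeg : (W₂ * W₁).rank < min d2 (min d1 d0)) :
    (∀ (V₂ : Matrix (Fin d2) (Fin d1) ℝ) (V₁ : Matrix (Fin d1) (Fin d0) ℝ),
      (1 / 2) * frob (W₂ * W₁ * X - Y) ^ 2 ≤ (1 / 2) * frob (V₂ * V₁ * X - Y) ^ 2) ∨
    (∃ (A : Matrix (Fin d2) (Fin d1) ℝ) (B : Matrix (Fin d1) (Fin d0) ℝ),
      deriv (fun t : ℝ =>
        (1 / 2) * frob ((W₂ + t • A) * (W₁ + t • B) * X - Y) ^ 2) 0 = 0 ∧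
      deriv (deriv (fun t : ℝ =>
        (1 / 2) * frob ((W₂ + t • A) * (W₁ + t • B) * X - Y) ^ 2)) 0 < 0) := by
  by_cases hG : (W₂ * W₁ * X - Y) * Xᵀ = 0
  · refine Or.inl fun V₂ V₁ => ?_
    have := frob_sq_le_of_mul_transpose_eq_zero X Y _ (V₂ * V₁) hG
    linarith
  refine Or.inr ?_
  obtain ⟨i, k, hik⟩ : ∃ i k, ((W₂ * W₁ * X - Y) * Xᵀ) i k ≠ 0 := by
    by_contra! h
    exact hG (Matrix.ext h)
  suffices h : ∃ (A : Matrix (Fin d2) (Fin d1) ℝ) (B : Matrix (Fin d1) (Fin d0) ℝ),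
      frob ((A * W₁ + W₂ * B) * X) ^ 2
      + 2 * ∑ i, ∑ k, ((W₂ * W₁ * X - Y) * Xᵀ) i k * (A * B) i k < 0 by
    obtain ⟨A, B, h⟩ := h
    exact ⟨A, B, (hcrit A B).deriv, by rwa [deriv_deriv_objective]⟩
  have hsum (s : ℝ) : ∑ i', ∑ k', ((W₂ * W₁ * X - Y) * Xᵀ) i' k'
      * (s • vecMulVec (Pi.single i 1) (Pi.single k 1) : Matrix _ _ ℝ) i' k'
      = s * ((W₂ * W₁ * X - Y) * Xᵀ) i k := by
    simp [vecMulVec_apply, Pi.single_apply, mul_comm]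
  by_cases h₂ : ∀ u, W₂ *ᵥ u = 0 → u = 0
  · by_cases h₁ : ∀ v, v ᵥ* W₁ = 0 → v = 0
    · have := rank_mul_eq_of_ker_eq_bot W₂ W₁ h₂ h₁
      omega
    · push Not at h₁
      obtain ⟨v, hv, hv0⟩ := h₁
      set A : Matrix (Fin d2) (Fin d1) ℝ := vecMulVec (Pi.single i 1) v
      set B : Matrix (Fin d1) (Fin d0) ℝ := vecMulVec ((v ⬝ᵥ v)⁻¹ • v) (Pi.single k 1)
      have hA : A * W₁ = 0 := by
        rw [vecMulVec_mul, hv]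
        ext
        simp [vecMulVec_apply]
      obtain ⟨s, hs⟩ := exists_add_mul_neg (frob (W₂ * B * X) ^ 2) hik
      refine ⟨s • A, B, ?_⟩
      rwa [Matrix.smul_mul, hA, smul_zero, zero_add, Matrix.smul_mul,
        vecMulVec_mul_vecMulVec_normalized _ hv0, hsum]
  · push Not at h₂
    obtain ⟨u, hu, hu0⟩ := h₂
    set A : Matrix (Fin d2) (Fin d1) ℝ := vecMulVec (Pi.single i 1) u
    set B : Matrix (Fin d1) (Fin d0) ℝ := vecMulVec ((u ⬝ᵥ u)⁻¹ • u) (Pi.single k 1)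
    have hB : W₂ * B = 0 := by simp [B, mul_vecMulVec, hu]
    obtain ⟨s, hs⟩ := exists_add_mul_neg (frob (A * W₁ * X) ^ 2) hik
    refine ⟨A, s • B, ?_⟩
    rwa [Matrix.mul_smul, hB, smul_zero, add_zero, Matrix.mul_smul,
      vecMulVec_mul_vecMulVec_normalized _ hu0, hsum]
end

section
/- Let ℓ : ℝ^{d2×n} → ℝ be convex and twice continuously differentiable, and let X ∈ ℝ^{d0×n} be arbitrary. Consider the objective f(W2, W1) = ℓ(W2·W1·X) with W2 ∈ ℝ^{d2×d1} and W1 ∈ ℝ^{d1×d0}. Every degenerate critical point (W̄2, W̄1) of f, i.e., a point where the gradient of f vanishes and rank(W̄2·W̄1) < min(d2, d1, d0), is either a global minimum of f or a second order saddle point: there exists a direction (A, B) such that g(t) = f(W̄2 + t·A, W̄1 + t·B) satisfies g′(0) = 0 and g″(0) < 0. -/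
open Matrix

attribute [local instance] Matrix.frobeniusNormedAddCommGroup Matrix.frobeniusNormedSpace

/-- The velocity of the parabola `z + t y + t² w`. -/
theorem hasDerivAt_parabola {E : Type*} [NormedAddCommGroup E] [NormedSpace ℝ E]
    (z y w : E) (t : ℝ) :
    HasDerivAt (fun t : ℝ => z + t • y + t ^ 2 • w) (y + (2 * t) • w) t := by
  simpa using (((hasDerivAt_id t).smul_const y).const_add z).fun_add
    ((hasDerivAt_pow 2 t).smul_const w)

/-- The derivative of a `C²` function along a parabola `z + t y + t² w`. -/
theorem hasDerivAt_comp_parabola {E : Type*} [NormedAddCommGroup E] [NormedSpace ℝ E]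
    {f : E → ℝ} (hf : ContDiff ℝ 2 f) (z y w : E) (t : ℝ) :
    HasDerivAt (fun t : ℝ => f (z + t • y + t ^ 2 • w))
      (fderiv ℝ f (z + t • y + t ^ 2 • w) (y + (2 * t) • w)) t :=
  ((hf.differentiable (by norm_num)) _).hasFDerivAt.comp_hasDerivAt t
    (hasDerivAt_parabola z y w t)

/-- The second derivative at `0` of a `C²` function along a parabola `z + t y + t² w`. -/
theorem deriv_deriv_comp_parabola {E : Type*} [NormedAddCommGroup E] [NormedSpace ℝ E]
    {f : E → ℝ} (hf : ContDiff ℝ 2 f) (z y w : E) :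
    deriv (deriv (fun t : ℝ => f (z + t • y + t ^ 2 • w))) 0 =
      fderiv ℝ (fderiv ℝ f) z y y + 2 * fderiv ℝ f z w := by
  rw [show deriv (fun t : ℝ => f (z + t • y + t ^ 2 • w)) = _ from
    funext fun t => (hasDerivAt_comp_parabola hf z y w t).deriv]
  have hv : HasDerivAt (fun t : ℝ => y + (2 * t) • w) ((2 : ℝ) • w) 0 := by
    simpa using (((hasDerivAt_id (0 : ℝ)).const_mul 2).smul_const w).const_add y
  have hf' : Differentiable ℝ (fderiv ℝ f) :=
    (hf.fderiv_right (m := 1) (by norm_num)).differentiable (by norm_num)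
  have hd := (hf' (z + (0 : ℝ) • y + (0 : ℝ) ^ 2 • w)).hasFDerivAt.comp_hasDerivAt
    (0 : ℝ) (hasDerivAt_parabola z y w 0)
  simpa using (hd.clm_apply hv).deriv

/-- A differentiable convex function lies above its tangent hyperplanes. -/
theorem ConvexOn.add_fderiv_le {E : Type*} [NormedAddCommGroup E] [NormedSpace ℝ E]
    {f : E → ℝ} (hc : ConvexOn ℝ Set.univ f) (hf : Differentiable ℝ f) (x y : E) :
    f x + fderiv ℝ f x (y - x) ≤ f y := by
  have hl : HasDerivAt (fun t : ℝ => AffineMap.lineMap x y t) (y - x) (0 : ℝ) :=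
    AffineMap.hasDerivAt_lineMap
  have hd : HasDerivAt (fun t : ℝ => f (AffineMap.lineMap x y t)) (fderiv ℝ f x (y - x)) 0 := by
    have h := (hf (AffineMap.lineMap x y (0 : ℝ))).hasFDerivAt.comp_hasDerivAt (0 : ℝ) hl
    simpa [Function.comp_def, -map_sub] using h
  have hg : ConvexOn ℝ Set.univ (fun t : ℝ => f (AffineMap.lineMap x y t)) := by
    simpa [Function.comp_def] using hc.comp_affineMap (AffineMap.lineMap (k := ℝ) x y)
  have h := hg.le_slope_of_hasDerivAt (Set.mem_univ 0) (Set.mem_univ 1) one_pos hd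
  simp [slope_def_field, -map_sub] at h
  linarith

/-- A matrix over a field with trivial kernel has a left inverse. -/
theorem Matrix.exists_mul_eq_one_of_ker {K m k : Type*} [Field K] [Fintype m] [Fintype k]
    [DecidableEq k] (U : Matrix m k K) (hU : ∀ u, U *ᵥ u = 0 → u = 0) :
    ∃ P : Matrix k m K, P * U = 1 := by
  classical
  obtain ⟨g, hg⟩ := U.mulVecLin.exists_leftInverse_of_injective (LinearMap.ker_eq_bot'.2 hU)
  refine ⟨LinearMap.toMatrix' g, ?_⟩
  have h := congrArg LinearMap.toMatrix' hg
  rwa [LinearMap.toMatrix'_comp, ← Matrix.toLin'_apply', LinearMap.toMatrix'_toLin',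
    LinearMap.toMatrix'_id] at h

/-- If neither factor has a kernel on the inner index, the product has rank at least the inner
dimension. -/
theorem Matrix.card_le_rank_mul {K m k p : Type*} [Field K] [Fintype m] [Fintype k] [Fintype p]
    (U : Matrix m k K) (V : Matrix k p K)
    (hU : ∀ u, U *ᵥ u = 0 → u = 0) (hV : ∀ v, v ᵥ* V = 0 → v = 0) :
    Fintype.card k ≤ (U * V).rank := by
  classical
  obtain ⟨P, hP⟩ := U.exists_mul_eq_one_of_ker hU
  obtain ⟨Q, hQ⟩ := Vᵀ.exists_mul_eq_one_of_ker
    fun v hv => hV v (by simpa [mulVec_transpose] using hv)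
  have hQ' : V * Qᵀ = 1 := by simpa using congrArg transpose hQ
  calc Fintype.card k = (P * (U * V) * Qᵀ).rank := by
        rw [← Matrix.mul_assoc, hP, Matrix.one_mul, hQ', rank_one]
    _ ≤ (P * (U * V)).rank := rank_mul_le_left _ _
    _ ≤ (U * V).rank := rank_mul_le_right _ _

/-- For a convex, twice continuously differentiable loss `ℓ` and arbitrary `X`,
every degenerate critical point of `f(W2, W1) = ℓ(W2·W1·X)` (vanishing gradient, i.e. vanishing
derivative in every direction, and `rank(W2·W1) < min(d2, d1, d0)`) is either a global minimum or
a second order saddle point: along some direction `(A, B)` the function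
`g(t) = f(W2 + tA, W1 + tB)` satisfies `g′(0) = 0` and `g″(0) < 0`. -/
theorem statement_8 {d0 d1 d2 n : ℕ}
    (ℓ : Matrix (Fin d2) (Fin n) ℝ → ℝ)
    (hconv : ConvexOn ℝ Set.univ ℓ) (hsmooth : ContDiff ℝ 2 ℓ)
    (X : Matrix (Fin d0) (Fin n) ℝ)
    (W₂ : Matrix (Fin d2) (Fin d1) ℝ) (W₁ : Matrix (Fin d1) (Fin d0) ℝ)
    (hcrit : ∀ (A : Matrix (Fin d2) (Fin d1) ℝ) (B : Matrix (Fin d1) (Fin d0) ℝ),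
      HasDerivAt (fun t : ℝ => ℓ ((W₂ + t • A) * (W₁ + t • B) * X)) 0 0)
    (hdeg : (W₂ * W₁).rank < min d2 (min d1 d0)) :
    (∀ (V₂ : Matrix (Fin d2) (Fin d1) ℝ) (V₁ : Matrix (Fin d1) (Fin d0) ℝ),
      ℓ (W₂ * W₁ * X) ≤ ℓ (V₂ * V₁ * X)) ∨
    (∃ (A : Matrix (Fin d2) (Fin d1) ℝ) (B : Matrix (Fin d1) (Fin d0) ℝ),
      deriv (fun t : ℝ => ℓ ((W₂ + t • A) * (W₁ + t • B) * X)) 0 = 0 ∧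
      deriv (deriv (fun t : ℝ => ℓ ((W₂ + t • A) * (W₁ + t • B) * X))) 0 < 0) := by
  have hpath : ∀ A B, (fun t : ℝ => ℓ ((W₂ + t • A) * (W₁ + t • B) * X)) =
      fun t : ℝ => ℓ (W₂ * W₁ * X + t • ((A * W₁ + W₂ * B) * X) + t ^ 2 • (A * B * X)) := by
    intro A B
    funext t
    congr 1
    simp only [Matrix.add_mul, Matrix.mul_add, Matrix.smul_mul, Matrix.mul_smul, smul_add,
      smul_smul, pow_two]
    abel
  by_cases hφ : ∀ a b, fderiv ℝ ℓ (W₂ * W₁ * X) (vecMulVec a b * X) = 0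
  · left
    intro V₂ V₁
    have hzero : ∀ M : Matrix (Fin d2) (Fin d0) ℝ, fderiv ℝ ℓ (W₂ * W₁ * X) (M * X) = 0 := by
      intro M
      rw [matrix_eq_sum_single M]
      simp only [Matrix.sum_mul, map_sum]
      refine Finset.sum_eq_zero fun i _ => Finset.sum_eq_zero fun j _ => ?_
      rw [← mul_one (M i j), ← smul_eq_mul, ← smul_single, single_eq_single_vecMulVec_single,
        Matrix.smul_mul, map_smul]
      exact (congrArg (M i j • ·) (hφ _ _)).trans (smul_zero _)
    calc ℓ (W₂ * W₁ * X)
        = ℓ (W₂ * W₁ * X) + fderiv ℝ ℓ (W₂ * W₁ * X) (V₂ * V₁ * X - W₂ * W₁ * X) := by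
          rw [← Matrix.sub_mul, hzero, add_zero]
      _ ≤ ℓ (V₂ * V₁ * X) :=
          hconv.add_fderiv_le (hsmooth.differentiable (by norm_num)) _ _
  · right
    push Not at hφ
    obtain ⟨a, b, hab⟩ := hφ
    have hscale : ∀ q : ℝ, ∃ s : ℝ,
        q + 2 * fderiv ℝ ℓ (W₂ * W₁ * X) (s • (vecMulVec a b * X)) < 0 := by
      intro q
      refine ⟨-(q + 1) / (2 * fderiv ℝ ℓ (W₂ * W₁ * X) (vecMulVec a b * X)), ?_⟩
      rw [map_smul, smul_eq_mul]
      have hq : ∀ c : ℝ, c ≠ 0 → q + 2 * (-(q + 1) / (2 * c) * c) = -1 := by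
        intro c hc
        field_simp
        ring
      exact (hq _ hab).trans_lt (by norm_num)
    have hker : (∃ u, W₂ *ᵥ u = 0 ∧ u ≠ 0) ∨ ∃ v, v ᵥ* W₁ = 0 ∧ v ≠ 0 := by
      by_contra! h
      have := Matrix.card_le_rank_mul W₂ W₁ h.1 h.2
      simp only [Fintype.card_fin] at this
      omega
    rcases hker with ⟨u, hu, hu0⟩ | ⟨v, hv, hv0⟩
    · have huu : u ⬝ᵥ u ≠ 0 := mt dotProduct_self_eq_zero.1 hu0
      set A := vecMulVec a ((u ⬝ᵥ u)⁻¹ • u)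
      obtain ⟨s, hs⟩ := hscale
        (fderiv ℝ (fderiv ℝ ℓ) (W₂ * W₁ * X) (A * W₁ * X) (A * W₁ * X))
      refine ⟨A, s • vecMulVec u b, (hcrit _ _).deriv, ?_⟩
      have hW : W₂ * (s • vecMulVec u b) = 0 := by
        rw [Matrix.mul_smul, mul_vecMulVec, hu, zero_vecMulVec, smul_zero]
      have hA : A * (s • vecMulVec u b) = s • vecMulVec a b := by
        simp [A, vecMulVec_mul_vecMulVec, huu]
      rw [hpath, deriv_deriv_comp_parabola hsmooth, hW, hA, add_zero, Matrix.smul_mul]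
      exact hs
    · have hvv : v ⬝ᵥ v ≠ 0 := mt dotProduct_self_eq_zero.1 hv0
      set B := vecMulVec ((v ⬝ᵥ v)⁻¹ • v) b
      obtain ⟨s, hs⟩ := hscale
        (fderiv ℝ (fderiv ℝ ℓ) (W₂ * W₁ * X) (W₂ * B * X) (W₂ * B * X))
      refine ⟨s • vecMulVec a v, B, (hcrit _ _).deriv, ?_⟩
      have hW : (s • vecMulVec a v) * W₁ = 0 := by
        rw [Matrix.smul_mul, vecMulVec_mul, hv]
        ext i j
        simp [vecMulVec_apply]
      have hB : (s • vecMulVec a v) * B = s • vecMulVec a b := by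
        simp [B, vecMulVec_mul_vecMulVec, smul_smul, mul_left_comm _ s, hvv]
      rw [hpath, deriv_deriv_comp_parabola hsmooth, hW, hB, zero_add, Matrix.smul_mul]
      exact hs
end
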